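/- arXiv:2304.10106 — 2 statements merged into one kernel-verified Lean document; each statement's English description precedes it below -/
import Mathlib

section
/- Matroids are 0-local spectral expanders (links have non-positive second eigenvalue). Let M be a matroid on a finite ground set E, and for S ⊆ E let N(S) denote the number of bases B of M with S ⊆ B. Let I be an independent set of M. Then for every f : E → ℝ satisfying ∑_{x ∈ E∖I} N(I∪{x})·f(x) = 0, it holds that ∑_{(x,y) : x,y ∈ E∖I, x ≠ y} N(I∪{x,y})·f(x)·f(y) ≤ 0 (the sum being over ordered pairs). Equivalently, the weighted link graph of I in the independence complex of M, whose edge {x,y} has weight proportional to N(I∪{x,y}), has second-largest random-walk eigenvalue at most 0. -/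
open Finset

/-- Maximum principle: if `A f = μ d f` with `μ` at least the top eigenvalue `m` of a connected
weighted graph, then `f` is constant on the support of `d`, so it cannot be orthogonal to `d`. -/
lemma false_of_large_eigenvalue_pos {α : Type*} [Fintype α] (A : α → α → ℝ) (d f : α → ℝ)
    (m μ : ℝ) (hm : 0 < m) (hμ : m ≤ μ) (hsymm : ∀ x y, A x y = A y x) (hA : ∀ x y, 0 ≤ A x y)
    (hrow : ∀ x, ∑ y, A x y = m * d x)
    (hconn : ∀ x z, 0 < d x → 0 < d z → 0 < A x z ∨ ∃ y, 0 < A x y ∧ 0 < A y z)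
    (hf : ∑ x, d x * f x = 0) (heig : ∀ x, ∑ y, A x y * f y = μ * (d x * f x))
    (x₀ : α) (hd₀ : 0 < d x₀) (hpos : 0 < f x₀) (hmax : ∀ y, 0 < d y → f y ≤ f x₀) : False := by
  have hd : ∀ x, 0 ≤ d x := fun x => by
    have h := Finset.sum_nonneg fun y (_ : y ∈ univ) => hA x y
    rw [hrow] at h
    exact nonneg_of_mul_nonneg_right h hm
  have hle : ∀ x y, A x y ≤ m * d y := fun x y => by
    rw [← hrow, hsymm]
    exact Finset.single_le_sum (f := fun z => A y z) (fun z _ => hA y z) (mem_univ x)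
  have hdpos : ∀ x y, 0 < A x y → 0 < d y := fun x y h =>
    pos_of_mul_pos_right (h.trans_le (hle x y)) hm.le
  have hstep : ∀ x, 0 < d x → f x = f x₀ → ∀ y, 0 < A x y → f y = f x₀ := by
    intro x hx hfx y hxy
    have hnn : ∀ z ∈ univ, 0 ≤ A x z * (f x₀ - f z) := by
      intro z _
      rcases (hA x z).eq_or_lt with h | h
      · simp [← h]
      · exact mul_nonneg h.le (sub_nonneg.2 (hmax z (hdpos x z h)))
    have hs : ∑ z, A x z * (f x₀ - f z) = (m - μ) * (d x * f x₀) := by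
      simp only [mul_sub, Finset.sum_sub_distrib, ← Finset.sum_mul, hrow, heig, hfx]
      ring
    have hs' : ∑ z, A x z * (f x₀ - f z) = 0 :=
      le_antisymm (hs ▸ mul_nonpos_of_nonpos_of_nonneg (sub_nonpos.2 hμ) (by positivity))
        (Finset.sum_nonneg hnn)
    have := (Finset.sum_eq_zero_iff_of_nonneg hnn).1 hs' y (mem_univ y)
    rcases mul_eq_zero.1 this with h | h
    · exact absurd h hxy.ne'
    · linarith
  have hconst : ∀ z, 0 < d z → f z = f x₀ := by
    intro z hz
    rcases hconn x₀ z hd₀ hz with h | ⟨y, h₁, h₂⟩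
    · exact hstep x₀ hd₀ rfl z h
    · exact hstep y (hdpos _ _ h₁) (hstep x₀ hd₀ rfl y h₁) z h₂
  have : 0 < ∑ x, d x * f x := by
    refine Finset.sum_pos' (fun x _ => ?_) ⟨x₀, mem_univ _, mul_pos hd₀ hpos⟩
    rcases (hd x).eq_or_lt with h | h
    · simp [← h]
    · rw [hconst x h]; positivity
  exact this.ne' hf

lemma false_of_large_eigenvalue {α : Type*} [Fintype α] (A : α → α → ℝ) (d f : α → ℝ)
    (m μ : ℝ) (hm : 0 < m) (hμ : m ≤ μ) (hsymm : ∀ x y, A x y = A y x) (hA : ∀ x y, 0 ≤ A x y)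
    (hrow : ∀ x, ∑ y, A x y = m * d x)
    (hconn : ∀ x z, 0 < d x → 0 < d z → 0 < A x z ∨ ∃ y, 0 < A x y ∧ 0 < A y z)
    (hf : ∑ x, d x * f x = 0) (heig : ∀ x, ∑ y, A x y * f y = μ * (d x * f x))
    (hne : ∃ x, 0 < d x ∧ f x ≠ 0) : False := by
  classical
  obtain ⟨x₁, hd₁, hf₁⟩ := hne
  obtain ⟨x₀, hx₀, hmax⟩ := Finset.exists_max_image (univ.filter fun x => 0 < d x)
    (fun x => |f x|) ⟨x₁, by simpa using hd₁⟩
  simp only [mem_filter, mem_univ, true_and] at hx₀ hmax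
  have h₀ : 0 < |f x₀| := (abs_pos.2 hf₁).trans_le (hmax x₁ hd₁)
  rcases lt_or_ge 0 (f x₀) with h | h
  · exact false_of_large_eigenvalue_pos A d f m μ hm hμ hsymm hA hrow hconn hf heig x₀ hx₀ h
      fun y hy => (le_abs_self _).trans ((hmax y hy).trans_eq (abs_of_pos h))
  · refine false_of_large_eigenvalue_pos A d (fun x => -f x) m μ hm hμ hsymm hA hrow hconn
      (by simpa using hf) (fun x => by simpa using heig x) x₀ hx₀ ?_ fun y hy => ?_
    · rwa [abs_of_nonpos h] at h₀
    · exact (neg_le_abs _).trans ((hmax y hy).trans_eq (abs_of_nonpos h))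

/-- **Trickling down.** If the random walk operator `P` of a connected weighted graph satisfies
`P ≤ P ^ 2`, then its second eigenvalue is nonpositive. -/
lemma quadForm_nonpos_of_le_sq {α : Type*} [Fintype α] (A : α → α → ℝ)
    (d : α → ℝ) (m : ℝ) (hm : 0 < m) (hsymm : ∀ x y, A x y = A y x) (hA : ∀ x y, 0 ≤ A x y)
    (hrow : ∀ x, ∑ y, A x y = m * d x)
    (hconn : ∀ x z, 0 < d x → 0 < d z → 0 < A x z ∨ ∃ y, 0 < A x y ∧ 0 < A y z)
    (hsq : ∀ f : α → ℝ, m * ∑ x, ∑ y, A x y * f x * f y ≤ ∑ x, (∑ y, A x y * f y) ^ 2 / d x)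
    (f : α → ℝ) (hf : ∑ x, d x * f x = 0) : ∑ x, ∑ y, A x y * f x * f y ≤ 0 := by
  classical
  have hd : ∀ x, 0 ≤ d x := fun x => by
    have h := Finset.sum_nonneg fun y (_ : y ∈ univ) => hA x y
    rw [hrow] at h
    exact nonneg_of_mul_nonneg_right h hm
  have hle : ∀ x y, A x y ≤ m * d x := fun x y => by
    rw [← hrow]
    exact Finset.single_le_sum (f := fun z => A x z) (fun z _ => hA x z) (mem_univ y)
  have hA0 : ∀ x y, d x = 0 → A x y = 0 := fun x y h =>
    le_antisymm (by simpa [h] using hle x y) (hA x y)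
  set s : α → ℝ := fun x => √(d x) with hs
  have hss : ∀ x, s x * s x = d x := fun x => Real.mul_self_sqrt (hd x)
  have hs0 : ∀ x, s x = 0 → d x = 0 := fun x h => by rw [← hss, h, zero_mul]
  have hAs : ∀ x y, s x * ((s x)⁻¹ * A x y) = A x y := fun x y => by
    by_cases h : s x = 0
    · simp [hA0 x y (hs0 x h)]
    · field_simp
  have hAs' : ∀ x y, A x y * (s y)⁻¹ * s y = A x y := fun x y => by
    rw [hsymm x y, mul_comm, mul_comm (A y x), hAs]
  set D := ∑ x, d x with hD
  let B : Matrix α α ℝ := Matrix.of fun x y =>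
    m / D * (s x * s y) - (s x)⁻¹ * A x y * (s y)⁻¹
  have hB : B.IsHermitian := by
    ext x y
    simp only [B, Matrix.conjTranspose_apply, Matrix.of_apply, star_trivial, hsymm y x]
    ring
  have hBv : ∀ (v : α → ℝ) x, (B.mulVec v) x =
      m / D * s x * (∑ y, s y * v y) - (s x)⁻¹ * ∑ y, A x y * ((s y)⁻¹ * v y) := by
    intro v x
    simp only [B, Matrix.mulVec, dotProduct, Matrix.of_apply, Finset.mul_sum,
      ← Finset.sum_sub_distrib]
    exact Finset.sum_congr rfl fun y _ => by ring
  have hpsd : B.PosSemidef := by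
    rw [hB.posSemidef_iff_eigenvalues_nonneg]
    intro i
    by_contra hneg
    simp only [Pi.zero_apply, not_le] at hneg
    set μ := -hB.eigenvalues i with hμ
    have hμpos : 0 < μ := by linarith
    set v : α → ℝ := ⇑(hB.eigenvectorBasis i) with hv
    have hvne : ∃ x, v x ≠ 0 := by
      by_contra! h
      apply hB.eigenvectorBasis.orthonormal.ne_zero i
      ext x
      exact h x
    set g : α → ℝ := fun x => (s x)⁻¹ * v x with hg
    set σ := ∑ y, s y * v y with hσ
    have he : ∀ x, (s x)⁻¹ * ∑ y, A x y * g y - m / D * s x * σ = μ * v x := by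
      intro x
      have h := congrFun (hB.mulVec_eigenvectorBasis i) x
      rw [← hv, hBv v x] at h
      simp only [Pi.smul_apply, smul_eq_mul] at h
      rw [hμ]
      linarith
    have hsupp : ∀ x, v x ≠ 0 → s x ≠ 0 := by
      intro x hx h0
      have := he x
      simp only [h0, inv_zero, zero_mul, mul_zero, sub_zero] at this
      rcases mul_eq_zero.1 this.symm with h | h
      · exact hμpos.ne' h
      · exact hx h
    have hdg : ∀ x, d x * g x = s x * v x := by
      intro x
      by_cases h : s x = 0
      · simp [h, hs0 x h]
      · rw [← hss, hg]; field_simp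
    obtain ⟨x₁, hx₁⟩ := hvne
    have hdx₁ : 0 < d x₁ := by
      rw [← hss]; exact mul_self_pos.2 (hsupp x₁ hx₁)
    have hDpos : 0 < D := Finset.sum_pos' (fun x _ => hd x) ⟨x₁, mem_univ _, hdx₁⟩
    have he' : ∀ x, ∑ y, A x y * g y - m / D * d x * σ = μ * (s x * v x) := by
      intro x
      have h := congrArg (s x * ·) (he x)
      simp only [mul_sub, Finset.mul_sum] at h
      rw [← hss x]
      calc _ = ∑ y, s x * ((s x)⁻¹ * (A x y * g y)) - s x * (m / D * s x * σ) := by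
            congr 1
            · exact Finset.sum_congr rfl fun y _ => by
                rw [← mul_assoc (s x)⁻¹, ← mul_assoc (s x), hAs]
            · ring
        _ = _ := by rw [h]; ring
    have hσ0 : σ = 0 := by
      have h : ∑ x, (∑ y, A x y * g y - m / D * d x * σ) = μ * σ := by
        rw [hσ, Finset.mul_sum]; exact Finset.sum_congr rfl fun x _ => he' x
      rw [Finset.sum_sub_distrib, Finset.sum_comm] at h
      have h₁ : ∑ y, ∑ x, A x y * g y = m * σ := by
        rw [hσ, Finset.mul_sum]
        refine Finset.sum_congr rfl fun y _ => ?_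
        rw [← Finset.sum_mul, ← hdg, ← mul_assoc m, ← hrow]
        simp only [hsymm y]
      have h₂ : ∑ x, m / D * d x * σ = m * σ := by
        rw [← Finset.sum_mul, ← Finset.mul_sum, ← hD]; field_simp
      rw [h₁, h₂, sub_self] at h
      exact (mul_eq_zero.1 h.symm).resolve_left hμpos.ne'
    have heig : ∀ x, ∑ y, A x y * g y = μ * (d x * g x) := by
      intro x
      have := he' x
      rw [hσ0] at this
      rw [hdg]; linarith
    have hgx₁ : g x₁ ≠ 0 := mul_ne_zero (inv_ne_zero (hsupp x₁ hx₁)) hx₁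
    have hnorm : 0 < ∑ x, d x * g x ^ 2 :=
      Finset.sum_pos' (fun x _ => mul_nonneg (hd x) (sq_nonneg _))
        ⟨x₁, mem_univ _, mul_pos hdx₁ (by positivity)⟩
    have hmμ : m ≤ μ := by
      have h := hsq g
      have h₁ : ∑ x, ∑ y, A x y * g x * g y = μ * ∑ x, d x * g x ^ 2 := by
        rw [Finset.mul_sum]
        refine Finset.sum_congr rfl fun x _ => ?_
        calc _ = g x * ∑ y, A x y * g y := by
              rw [Finset.mul_sum]; exact Finset.sum_congr rfl fun y _ => by ring
          _ = _ := by rw [heig]; ring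
      have h₂ : ∑ x, (∑ y, A x y * g y) ^ 2 / d x = μ * (μ * ∑ x, d x * g x ^ 2) := by
        rw [Finset.mul_sum, Finset.mul_sum]
        refine Finset.sum_congr rfl fun x _ => ?_
        rw [heig]
        by_cases h : d x = 0
        · simp [h]
        · field_simp
      rw [h₁, h₂] at h
      exact le_of_mul_le_mul_right h (by positivity)
    refine false_of_large_eigenvalue A d g m μ hm hmμ hsymm hA hrow hconn ?_ heig
      ⟨x₁, hdx₁, hgx₁⟩
    rw [← hσ0, hσ]
    exact Finset.sum_congr rfl fun x _ => hdg x
  have hfin := hpsd.dotProduct_mulVec_nonneg (fun x => s x * f x)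
  have hz : ∑ y, s y * (s y * f y) = 0 := by
    rw [← hf]; exact Finset.sum_congr rfl fun y _ => by rw [← mul_assoc, hss]
  have hsf : ∀ x y, A x y * ((s y)⁻¹ * (s y * f y)) = A x y * f y := fun x y => by
    rw [← mul_assoc, ← mul_assoc, hAs']
  have hval : star (fun x => s x * f x) ⬝ᵥ B.mulVec (fun x => s x * f x)
      = -∑ x, ∑ y, A x y * f x * f y := by
    simp only [dotProduct, hBv, hz, hsf, Pi.star_apply, star_trivial]
    rw [← Finset.sum_neg_distrib]
    refine Finset.sum_congr rfl fun x _ => ?_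
    rw [mul_zero, zero_sub, mul_neg, neg_inj, Finset.mul_sum, Finset.mul_sum]
    refine Finset.sum_congr rfl fun y _ => ?_
    calc _ = (s x * ((s x)⁻¹ * A x y)) * f x * f y := by ring
      _ = _ := by rw [hAs]
  rw [hval] at hfin
  linarith

/-- The homogeneous form of the second-eigenvalue bound. -/
lemma mul_quadForm_le_of_nonpos {α : Type*} [Fintype α] (A : α → α → ℝ)
    (d : α → ℝ) (m : ℝ) (hsymm : ∀ x y, A x y = A y x)
    (hrow : ∀ x, ∑ y, A x y = m * d x) (hD : 0 < ∑ x, d x)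
    (h : ∀ f : α → ℝ, ∑ x, d x * f x = 0 → ∑ x, ∑ y, A x y * f x * f y ≤ 0) (f : α → ℝ) :
    (∑ x, d x) * ∑ x, ∑ y, A x y * f x * f y ≤ m * (∑ x, d x * f x) ^ 2 := by
  set D := ∑ x, d x with hDdef
  set c := ∑ x, d x * f x with hc
  have h₀ := h (fun x => D * f x - c) (by
    simp only [mul_sub, Finset.sum_sub_distrib, ← Finset.sum_mul]
    rw [← hDdef, sub_eq_zero, mul_comm D, hc, Finset.sum_mul]
    exact Finset.sum_congr rfl fun x _ => by ring)
  have h₁ : ∑ x, ∑ y, A x y * f x = m * c := by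
    rw [hc, Finset.mul_sum]
    exact Finset.sum_congr rfl fun x _ => by rw [← Finset.sum_mul, hrow]; ring
  have h₂ : ∑ x, ∑ y, A x y * f y = m * c := by
    rw [Finset.sum_comm, ← h₁]; simp only [hsymm]
  have h₃ : ∑ x, ∑ y, A x y = m * D := by simp only [hrow, hDdef, Finset.mul_sum]
  have h₄ : ∑ x, ∑ y, A x y * (D * f x - c) * (D * f y - c) =
      D ^ 2 * ∑ x, ∑ y, A x y * f x * f y - D * c * ∑ x, ∑ y, A x y * f x
        - D * c * ∑ x, ∑ y, A x y * f y + c ^ 2 * ∑ x, ∑ y, A x y := by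
    simp only [Finset.mul_sum, ← Finset.sum_sub_distrib, ← Finset.sum_add_distrib]
    exact Finset.sum_congr rfl fun x _ => Finset.sum_congr rfl fun y _ => by ring
  rw [h₄, h₁, h₂, h₃] at h₀
  refine le_of_mul_le_mul_left (a := D) ?_ hD
  linarith

/-- A complete multipartite graph has at most one positive eigenvalue. -/
lemma multipartite_quadForm_nonpos {α β : Type*} [DecidableEq β] (U : Finset α)
    (c : α → β) (f : α → ℝ)
    (hf : ∑ x ∈ U, (∑ y ∈ U, if c x = c y then 0 else 1) * f x = 0) :
    ∑ x ∈ U, ∑ y ∈ U, (if c x = c y then 0 else 1) * f x * f y ≤ 0 := by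
  rcases U.eq_empty_or_nonempty with rfl | hU
  · simp
  set g : β → ℝ := fun b => ∑ x ∈ U with c x = b, f x with hg
  set n : β → ℝ := fun b => ∑ x ∈ U with c x = b, 1 with hn
  have key : ∀ p q : α → ℝ, ∑ x ∈ U, ∑ y ∈ U, (if c x = c y then 0 else 1) * p x * q y =
      (∑ x ∈ U, p x) * (∑ x ∈ U, q x)
      - ∑ b ∈ U.image c, (∑ x ∈ U with c x = b, p x) * ∑ x ∈ U with c x = b, q x := by
    intro p q
    have h₁ : ∑ b ∈ U.image c, (∑ x ∈ U with c x = b, p x) * ∑ x ∈ U with c x = b, q x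
        = ∑ x ∈ U, ∑ y ∈ U, (if c x = c y then 1 else 0) * p x * q y := by
      rw [← Finset.sum_fiberwise_of_maps_to (g := c) (t := U.image c)
        (fun x hx => mem_image_of_mem c hx)]
      refine Finset.sum_congr rfl fun b _ => ?_
      rw [Finset.sum_mul]
      refine Finset.sum_congr rfl fun x hx => ?_
      rw [Finset.mul_sum, Finset.sum_filter]
      refine Finset.sum_congr rfl fun y _ => ?_
      rw [(mem_filter.1 hx).2]
      simp [eq_comm]
    rw [h₁, Finset.sum_mul_sum, ← Finset.sum_sub_distrib]
    refine Finset.sum_congr rfl fun x _ => ?_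
    rw [← Finset.sum_sub_distrib]
    refine Finset.sum_congr rfl fun y _ => ?_
    split_ifs <;> ring
  have e₁ : (∑ x ∈ U, f x) * (∑ x ∈ U, (1 : ℝ)) = ∑ b ∈ U.image c, g b * n b := by
    have := key f 1
    simp only [Pi.one_apply, mul_one] at this
    simp only [Finset.sum_mul] at hf
    rw [hf] at this
    simp only [hg, hn]
    linarith
  have e₂ : ∑ b ∈ U.image c, n b = ∑ x ∈ U, (1 : ℝ) :=
    Finset.sum_fiberwise_of_maps_to (fun x hx => mem_image_of_mem c hx) _
  have hn0 : ∀ b ∈ U.image c, 0 ≤ n b := fun b _ => Finset.sum_nonneg fun _ _ => zero_le_one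
  have e₃ : ∑ b ∈ U.image c, n b ^ 2 ≤ (∑ x ∈ U, (1 : ℝ)) ^ 2 := by
    rw [← e₂]; exact Finset.sum_sq_le_sq_sum_of_nonneg hn0
  have hcs := Finset.sum_mul_sq_le_sq_mul_sq (U.image c) g n
  rw [← e₁] at hcs
  rw [key f f]
  have hpos : 0 < ∑ x ∈ U, (1 : ℝ) := Finset.sum_pos (fun _ _ => zero_lt_one) hU
  have hg0 : 0 ≤ ∑ b ∈ U.image c, g b ^ 2 := Finset.sum_nonneg fun _ _ => sq_nonneg _
  have h := hcs.trans (mul_le_mul_of_nonneg_left e₃ hg0)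
  rw [mul_pow] at h
  have := le_of_mul_le_mul_right h (by positivity)
  simp only [pow_two, hg] at this
  linarith

/-- The properties of the function counting the bases of a rank `r` matroid `ℐ` that contain a
given set, on which the spectral bound depends. -/
structure IsBasisCount {α : Type*} [Fintype α] [DecidableEq α] (ℐ : Finset (Finset α)) (r : ℕ)
    (N : Finset α → ℝ) : Prop where
  exch : ∀ T₁ ∈ ℐ, ∀ T₂ ∈ ℐ, T₂.card < T₁.card → ∃ i ∈ T₁ \ T₂, insert i T₂ ∈ ℐ
  card_le : ∀ S ∈ ℐ, S.card ≤ r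
  exists_card_eq : ∃ B ∈ ℐ, B.card = r
  pos : ∀ S ∈ ℐ, 0 < N S
  eq_zero : ∀ S ∉ ℐ, N S = 0
  eq_one : ∀ S ∈ ℐ, S.card = r → N S = 1
  sum_insert : ∀ S, ∑ x ∈ Sᶜ, N (insert x S) = (r - S.card) * N S

section Link

variable {α : Type*} [DecidableEq α]

/-- The weight of the edge `{x, y}` in the link of `I`. -/
def linkWeight (N : Finset α → ℝ) (I : Finset α) (x y : α) : ℝ :=
  if x ≠ y ∧ x ∉ I ∧ y ∉ I then N (insert x (insert y I)) else 0

/-- The weight of the vertex `x` in the link of `I`. -/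
def linkDegree (N : Finset α → ℝ) (I : Finset α) (x : α) : ℝ :=
  if x ∉ I then N (insert x I) else 0

lemma linkWeight_comm (N : Finset α → ℝ) (I : Finset α) (x y : α) :
    linkWeight N I x y = linkWeight N I y x := by
  unfold linkWeight
  rw [Finset.insert_comm]
  exact if_congr (by tauto) rfl rfl

lemma linkDegree_insert (N : Finset α → ℝ) {I : Finset α} {x : α} (hx : x ∉ I) (y : α) :
    linkDegree N (insert x I) y = linkWeight N I x y := by
  unfold linkWeight linkDegree
  rw [Finset.insert_comm x y]
  refine if_congr ?_ rfl rfl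
  rw [mem_insert]
  tauto

namespace IsBasisCount

variable [Fintype α] {ℐ : Finset (Finset α)} {r : ℕ} {N : Finset α → ℝ}

lemma nonneg (h : IsBasisCount ℐ r N) (S : Finset α) : 0 ≤ N S := by
  by_cases hS : S ∈ ℐ
  · exact (h.pos S hS).le
  · exact (h.eq_zero S hS).ge

lemma mem_of_pos (h : IsBasisCount ℐ r N) {S : Finset α} (hS : 0 < N S) : S ∈ ℐ := by
  by_contra hn
  exact hS.ne' (h.eq_zero S hn)

lemma linkWeight_nonneg (h : IsBasisCount ℐ r N) (I : Finset α) (x y : α) :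
    0 ≤ linkWeight N I x y := by
  unfold linkWeight
  split_ifs
  exacts [h.nonneg _, le_rfl]

lemma sum_linkDegree (h : IsBasisCount ℐ r N) (I : Finset α) :
    ∑ x, linkDegree N I x = (r - I.card) * N I := by
  rw [← h.sum_insert]
  simp only [linkDegree, ← Finset.sum_filter]
  exact Finset.sum_congr (by ext; simp) fun _ _ => rfl

lemma sum_linkWeight (h : IsBasisCount ℐ r N) (I : Finset α) (x : α) :
    ∑ y, linkWeight N I x y = (r - I.card - 1) * linkDegree N I x := by
  by_cases hx : x ∈ I
  · simp [linkWeight, linkDegree, hx]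
  · simp only [← linkDegree_insert N hx, h.sum_linkDegree]
    rw [linkDegree, if_pos hx, card_insert_of_notMem hx]
    push_cast
    ring

lemma sum_linkWeight_insert (h : IsBasisCount ℐ r N) (I : Finset α) (y z : α) :
    ∑ x ∈ Iᶜ, linkWeight N (insert x I) y z = (r - I.card - 2) * linkWeight N I y z := by
  by_cases hyz : y ≠ z ∧ y ∉ I ∧ z ∉ I
  · have hcard : (insert y (insert z I)).card = I.card + 2 := by
      rw [card_insert_of_notMem (by simp [hyz]), card_insert_of_notMem hyz.2.2]
    have := h.sum_insert (insert y (insert z I))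
    rw [hcard] at this
    unfold linkWeight
    rw [if_pos hyz]
    push_cast at this
    rw [sub_sub, ← this, ← Finset.sum_filter]
    refine Finset.sum_congr ?_ fun x _ => ?_
    · ext x
      simp only [mem_filter, mem_compl, mem_insert]
      grind
    · rw [Finset.insert_comm x y, Finset.insert_comm x z]
  · have h0 : ∀ x, linkWeight N (insert x I) y z = 0 := fun x => by
      unfold linkWeight
      refine if_neg fun hn => hyz ?_
      simp only [mem_insert, not_or] at hn
      tauto
    rw [Finset.sum_eq_zero fun x _ => h0 x, linkWeight, if_neg hyz, mul_zero]

lemma exchange_pair (h : IsBasisCount ℐ r N) {I : Finset α} {x y z : α} (hx : x ∉ I)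
    (hz : z ∉ I) (hxz : x ≠ z) (hxz' : insert x (insert z I) ∈ ℐ) (hy : y ∉ I)
    (hy' : insert y I ∈ ℐ) :
    (x ≠ y ∧ insert x (insert y I) ∈ ℐ) ∨ (z ≠ y ∧ insert z (insert y I) ∈ ℐ) := by
  obtain ⟨i, hi, hi'⟩ := h.exch _ hxz' _ hy' (by
    rw [card_insert_of_notMem (s := insert z I) (by simp [hxz, hx]), card_insert_of_notMem hz,
      card_insert_of_notMem hy]
    lia)
  simp only [mem_sdiff, mem_insert, not_or] at hi
  rcases hi with ⟨rfl | rfl | hiI, hiy, hiI'⟩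
  · exact Or.inl ⟨hiy, hi'⟩
  · exact Or.inr ⟨hiy, hi'⟩
  · exact absurd hiI hiI'

lemma linkWeight_pos (h : IsBasisCount ℐ r N) {I : Finset α} {x y : α} (hx : x ∉ I) (hy : y ∉ I)
    (hxy : x ≠ y) (hI : insert x (insert y I) ∈ ℐ) : 0 < linkWeight N I x y := by
  unfold linkWeight
  rw [if_pos ⟨hxy, hx, hy⟩]
  exact h.pos _ hI

lemma of_linkDegree_pos (h : IsBasisCount ℐ r N) {I : Finset α} {x : α}
    (hx : 0 < linkDegree N I x) : x ∉ I ∧ insert x I ∈ ℐ := by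
  unfold linkDegree at hx
  split_ifs at hx with hxI
  · exact absurd hx (lt_irrefl _)
  · exact ⟨hxI, h.mem_of_pos hx⟩

lemma link_connected (h : IsBasisCount ℐ r N) {I : Finset α} (hr : I.card + 2 ≤ r) (x z : α)
    (hx : 0 < linkDegree N I x) (hz : 0 < linkDegree N I z) :
    0 < linkWeight N I x z ∨ ∃ y, 0 < linkWeight N I x y ∧ 0 < linkWeight N I y z := by
  obtain ⟨hxI, hxI'⟩ := h.of_linkDegree_pos hx
  obtain ⟨hzI, hzI'⟩ := h.of_linkDegree_pos hz
  obtain ⟨B, hB, hBr⟩ := h.exists_card_eq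
  obtain ⟨y, hy, hy'⟩ := h.exch B hB _ hxI' (by rw [card_insert_of_notMem hxI, hBr]; lia)
  simp only [mem_sdiff, mem_insert, not_or] at hy
  obtain ⟨-, hyx, hyI⟩ := hy
  have hxy : 0 < linkWeight N I x y := by
    rw [linkWeight_comm]
    exact h.linkWeight_pos hyI hxI hyx hy'
  rcases h.exchange_pair hyI hxI hyx hy' hzI hzI' with ⟨h₁, h₂⟩ | ⟨h₁, h₂⟩
  · exact Or.inr ⟨y, hxy, h.linkWeight_pos hyI hzI h₁ h₂⟩
  · exact Or.inl (h.linkWeight_pos hxI hzI h₁ h₂)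

lemma linkWeight_eq_zero_of_linkDegree (h : IsBasisCount ℐ r N) {I : Finset α} {x : α}
    (hx : linkDegree N I x = 0) (y : α) : linkWeight N I x y = 0 := by
  have hs := h.sum_linkWeight I x
  rw [hx, mul_zero, Finset.sum_eq_zero_iff_of_nonneg fun y _ => h.linkWeight_nonneg I x y] at hs
  exact hs y (mem_univ y)

/-- In corank two the link is a complete multipartite graph. -/
lemma exists_multipartite (h : IsBasisCount ℐ r N) {I : Finset α} (hr : I.card + 2 = r) :
    ∃ c : α → Finset α, ∀ x y, 0 < linkDegree N I x → 0 < linkDegree N I y →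
      linkWeight N I x y = if c x = c y then 0 else 1 := by
  set U := univ.filter fun x => x ∉ I ∧ insert x I ∈ ℐ with hU
  set adj : α → α → Prop := fun x y => x ≠ y ∧ insert x (insert y I) ∈ ℐ with hadj
  have hcomm : ∀ x y, adj x y → adj y x := fun x y hxy => ⟨hxy.1.symm, by
    rw [Finset.insert_comm]; exact hxy.2⟩
  have htrans : ∀ x y z, x ∈ U → y ∈ U → z ∈ U → adj x z → adj x y ∨ adj z y := by
    intro x y z hx hy hz hxz
    simp only [hU, mem_filter, mem_univ, true_and] at hx hy hz
    exact h.exchange_pair hx.1 hz.1 hxz.1 hxz.2 hy.1 hy.2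
  refine ⟨fun x => U.filter fun y => ¬ adj x y, fun x y hx hy => ?_⟩
  have hx' := h.of_linkDegree_pos hx
  have hy' := h.of_linkDegree_pos hy
  have hxU : x ∈ U := by simpa [hU] using hx'
  have hyU : y ∈ U := by simpa [hU] using hy'
  have hiff : ((U.filter fun z => ¬ adj x z) = U.filter fun z => ¬ adj y z) ↔ ¬ adj x y := by
    constructor
    · intro he
      have : y ∈ U.filter fun z => ¬ adj y z := mem_filter.2 ⟨hyU, fun hn => hn.1 rfl⟩
      rw [← he] at this
      exact (mem_filter.1 this).2
    · intro hn
      refine Finset.filter_congr fun z hz => not_congr ⟨fun hxz => ?_, fun hyz => ?_⟩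
      · exact hcomm _ _ ((htrans x y z hxU hyU hz hxz).resolve_left hn)
      · exact hcomm _ _ ((htrans y x z hyU hxU hz hyz).resolve_left fun hyx => hn (hcomm _ _ hyx))
  by_cases hxy : adj x y
  · rw [if_neg (fun he => hiff.1 he hxy)]
    unfold linkWeight
    rw [if_pos ⟨hxy.1, hx'.1, hy'.1⟩]
    refine h.eq_one _ hxy.2 ?_
    rw [card_insert_of_notMem (by simp [hxy.1, hx'.1]), card_insert_of_notMem hy'.1, ← hr]
  · rw [if_pos (hiff.2 hxy)]
    unfold linkWeight
    split_ifs with hc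
    · exact h.eq_zero _ fun hm => hxy ⟨hc.1, hm⟩
    · rfl

lemma linkDegree_nonneg (h : IsBasisCount ℐ r N) (I : Finset α) (x : α) :
    0 ≤ linkDegree N I x := by
  unfold linkDegree
  split_ifs
  exacts [le_rfl, h.nonneg _]

lemma quadForm_nonpos_of_corank_two (h : IsBasisCount ℐ r N) {I : Finset α}
    (hr : I.card + 2 = r) (f : α → ℝ) (hf : ∑ x, linkDegree N I x * f x = 0) :
    ∑ x, ∑ y, linkWeight N I x y * f x * f y ≤ 0 := by
  obtain ⟨c, hc⟩ := h.exists_multipartite hr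
  set U := univ.filter fun x => 0 < linkDegree N I x with hU
  have hmem : ∀ x, x ∈ U ↔ 0 < linkDegree N I x := fun x => by simp [hU]
  have hout : ∀ x, x ∉ U → linkDegree N I x = 0 := fun x hx =>
    le_antisymm (not_lt.1 fun hp => hx ((hmem x).2 hp)) (h.linkDegree_nonneg I x)
  have hW : ∀ x, x ∉ U → ∀ y, linkWeight N I x y = 0 := fun x hx =>
    h.linkWeight_eq_zero_of_linkDegree (hout x hx)
  have hW' : ∀ y, y ∉ U → ∀ x, linkWeight N I x y = 0 := fun y hy x => by
    rw [linkWeight_comm, hW y hy]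
  have hdeg : ∀ x ∈ U, ∑ y ∈ U, (if c x = c y then (0 : ℝ) else 1) = linkDegree N I x := by
    intro x hx
    have hs := h.sum_linkWeight I x
    rw [← hr] at hs
    push_cast at hs
    rw [show ((I.card : ℝ) + 2 - I.card - 1) = 1 by ring, one_mul] at hs
    rw [← hs, ← Finset.sum_subset (subset_univ U) fun y _ hy => hW' y hy x]
    exact Finset.sum_congr rfl fun y hy => (hc x y ((hmem x).1 hx) ((hmem y).1 hy)).symm
  have key := multipartite_quadForm_nonpos U c f (by
    refine Eq.trans ?_ hf
    rw [← Finset.sum_subset (subset_univ U) fun x _ hx => by rw [hout x hx, zero_mul]]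
    exact Finset.sum_congr rfl fun x hx => by rw [hdeg x hx])
  refine le_of_eq_of_le ?_ key
  rw [← Finset.sum_subset (subset_univ U) fun x _ hx => by simp [hW x hx]]
  refine Finset.sum_congr rfl fun x hx => ?_
  rw [← Finset.sum_subset (subset_univ U) fun y _ hy => by simp [hW' y hy]]
  exact Finset.sum_congr rfl fun y hy => by rw [hc x y ((hmem x).1 hx) ((hmem y).1 hy)]

lemma quadForm_nonpos_of_insert (h : IsBasisCount ℐ r N) {I : Finset α} (hr : I.card + 3 ≤ r)
    (ih : ∀ x ∉ I, insert x I ∈ ℐ → ∀ f : α → ℝ,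
      ∑ y, linkDegree N (insert x I) y * f y = 0 →
        ∑ y, ∑ z, linkWeight N (insert x I) y z * f y * f z ≤ 0)
    (f : α → ℝ) (hf : ∑ x, linkDegree N I x * f x = 0) :
    ∑ x, ∑ y, linkWeight N I x y * f x * f y ≤ 0 := by
  have hr' : (I.card : ℝ) + 3 ≤ r := by exact_mod_cast hr
  set m : ℝ := r - I.card - 1 with hm
  have hm0 : 0 < m := by linarith
  have hm1 : 0 < m - 1 := by linarith
  refine quadForm_nonpos_of_le_sq (linkWeight N I) (linkDegree N I) m hm0 (linkWeight_comm N I)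
    (h.linkWeight_nonneg I) (h.sum_linkWeight I) (h.link_connected (by lia)) (fun g => ?_) f hf
  have hlocal : ∀ x ∈ Iᶜ, m * ∑ y, ∑ z, linkWeight N (insert x I) y z * g y * g z ≤
      (m - 1) * ((∑ y, linkWeight N I x y * g y) ^ 2 / linkDegree N I x) := by
    intro x hx
    rw [mem_compl] at hx
    have hdx : linkDegree N I x = N (insert x I) := if_pos hx
    have hsum : ∑ y, linkDegree N (insert x I) y = m * linkDegree N I x := by
      simp only [linkDegree_insert N hx, h.sum_linkWeight I x, hm]
    rcases (h.linkDegree_nonneg I x).eq_or_lt with h0 | hpos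
    · have hz : ∀ y z, linkWeight N (insert x I) y z = 0 := fun y z => by
        refine h.linkWeight_eq_zero_of_linkDegree ?_ z
        rw [linkDegree_insert N hx]
        exact h.linkWeight_eq_zero_of_linkDegree h0.symm y
      simp [hz, ← h0]
    · have hcard : ((insert x I).card : ℝ) = I.card + 1 := by
        rw [card_insert_of_notMem hx]; push_cast; rfl
      have := mul_quadForm_le_of_nonpos (linkWeight N (insert x I)) (linkDegree N (insert x I))
        (m - 1) (linkWeight_comm N _)
        (fun y => by rw [h.sum_linkWeight, hcard, hm]; ring)
        (by rw [hsum]; positivity)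
        (ih x hx (h.mem_of_pos (hdx ▸ hpos))) g
      rw [hsum] at this
      simp only [linkDegree_insert N hx] at this
      rw [← mul_div_assoc, le_div_iff₀ hpos]
      linarith
  have hsumQ : ∑ x ∈ Iᶜ, ∑ y, ∑ z, linkWeight N (insert x I) y z * g y * g z =
      (m - 1) * ∑ y, ∑ z, linkWeight N I y z * g y * g z := by
    rw [Finset.sum_comm, Finset.mul_sum]
    refine Finset.sum_congr rfl fun y _ => ?_
    rw [Finset.sum_comm, Finset.mul_sum]
    refine Finset.sum_congr rfl fun z _ => ?_
    rw [← Finset.sum_mul, ← Finset.sum_mul, h.sum_linkWeight_insert, hm]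
    ring
  have hle := Finset.sum_le_sum hlocal
  rw [← Finset.mul_sum, ← Finset.mul_sum, hsumQ,
    Finset.sum_subset (subset_univ Iᶜ) fun x _ hx => by
      rw [mem_compl, not_not] at hx
      simp [linkDegree, hx]] at hle
  refine le_of_mul_le_mul_left (a := m - 1) ?_ hm1
  linarith

theorem quadForm_nonpos (h : IsBasisCount ℐ r N) {I : Finset α} (hI : I ∈ ℐ)
    (f : α → ℝ) (hf : ∑ x, linkDegree N I x * f x = 0) :
    ∑ x, ∑ y, linkWeight N I x y * f x * f y ≤ 0 := by
  obtain ⟨k, hk⟩ := Nat.exists_eq_add_of_le (h.card_le I hI)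
  induction k using Nat.strong_induction_on generalizing I f with
  | _ k ih =>
    rcases lt_trichotomy k 2 with h2 | h2 | h2
    · have hz : ∀ x y, linkWeight N I x y = 0 := fun x y => by
        unfold linkWeight
        split_ifs with hxy
        · refine h.eq_zero _ fun hm => ?_
          have := h.card_le _ hm
          rw [card_insert_of_notMem (by simp [hxy]), card_insert_of_notMem hxy.2.2] at this
          lia
        · rfl
      simp [hz]
    · exact h.quadForm_nonpos_of_corank_two (by lia) f hf
    · refine h.quadForm_nonpos_of_insert (by lia) (fun x hx hxI g hg => ?_) f hf
      exact ih (k - 1) (by lia) hxI g hg (by rw [card_insert_of_notMem hx]; lia)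

end IsBasisCount

end Link

/-- The number of bases containing a set is a basis count. -/
lemma isBasisCount_card_filter {α : Type*} [Fintype α] [DecidableEq α]
    (ℐ : Finset (Finset α)) (hne : ℐ.Nonempty)
    (hdown : ∀ T ∈ ℐ, ∀ S ⊆ T, S ∈ ℐ)
    (hexch : ∀ T₁ ∈ ℐ, ∀ T₂ ∈ ℐ, T₂.card < T₁.card → ∃ i ∈ T₁ \ T₂, insert i T₂ ∈ ℐ) :
    ∃ r, IsBasisCount ℐ r fun S =>
      ((ℐ.filter fun B => (∀ T ∈ ℐ, B ⊆ T → B = T) ∧ S ⊆ B).card : ℝ) := by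
  obtain ⟨B₀, hB₀, hmax⟩ := Finset.exists_max_image ℐ Finset.card hne
  have hbasis : ∀ B ∈ ℐ, (∀ T ∈ ℐ, B ⊆ T → B = T) ↔ B.card = B₀.card := by
    intro B hB
    constructor
    · intro hm
      refine le_antisymm (hmax B hB) (not_lt.1 fun hlt => ?_)
      obtain ⟨i, hi, hi'⟩ := hexch B₀ hB₀ B hB hlt
      have := hm _ hi' (subset_insert i B)
      exact (mem_sdiff.1 hi).2 (this ▸ mem_insert_self i B)
    · intro hc T hT hBT
      exact Finset.eq_of_subset_of_card_le hBT (hc ▸ hmax T hT)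
  have hext : ∀ n, ∀ S ∈ ℐ, S.card + n = B₀.card → ∃ B ∈ ℐ, B.card = B₀.card ∧ S ⊆ B := by
    intro n
    induction n with
    | zero => exact fun S hS hc => ⟨S, hS, hc, Subset.rfl⟩
    | succ n ih =>
      intro S hS hc
      obtain ⟨i, hi, hi'⟩ := hexch B₀ hB₀ S hS (by lia)
      obtain ⟨B, hB, hBc, hSB⟩ := ih _ hi' (by
        rw [card_insert_of_notMem (mem_sdiff.1 hi).2]; lia)
      exact ⟨B, hB, hBc, (subset_insert i S).trans hSB⟩
  have hfilter : ∀ S : Finset α, (ℐ.filter fun B => (∀ T ∈ ℐ, B ⊆ T → B = T) ∧ S ⊆ B) =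
      (ℐ.filter fun B => B.card = B₀.card).filter fun B => S ⊆ B := by
    intro S
    rw [Finset.filter_filter]
    exact Finset.filter_congr fun B hB => and_congr_left' (hbasis B hB)
  simp only [hfilter]
  refine ⟨B₀.card, hexch, hmax, ⟨B₀, hB₀, rfl⟩, fun S hS => ?_, fun S hS => ?_,
    fun S hS hc => ?_, fun S => ?_⟩
  · obtain ⟨n, hn⟩ := Nat.exists_eq_add_of_le (hmax S hS)
    obtain ⟨B, hB, hBc, hSB⟩ := hext n S hS hn.symm
    exact_mod_cast Finset.card_pos.2 ⟨B, by simp [hB, hBc, hSB]⟩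
  · rw [Nat.cast_eq_zero, Finset.card_eq_zero, Finset.filter_eq_empty_iff]
    exact fun B hB hSB => hS (hdown B (mem_filter.1 hB).1 S hSB)
  · rw [Nat.cast_eq_one, Finset.card_eq_one]
    refine ⟨S, ?_⟩
    ext B
    simp only [mem_filter, mem_singleton]
    constructor
    · rintro ⟨⟨-, hBc⟩, hSB⟩
      exact (Finset.eq_of_subset_of_card_le hSB (by lia)).symm
    · rintro rfl
      exact ⟨⟨hS, hc⟩, Subset.rfl⟩
  · set 𝓑 := ℐ.filter fun B => B.card = B₀.card with h𝓑
    have hcount : ∀ T : Finset α, ((𝓑.filter fun B => T ⊆ B).card : ℝ) =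
        ∑ B ∈ 𝓑, if T ⊆ B then 1 else 0 := fun T => by
      rw [Finset.card_filter]; push_cast; rfl
    simp only [hcount]
    rw [Finset.sum_comm, Finset.mul_sum]
    refine Finset.sum_congr rfl fun B hB => ?_
    by_cases hSB : S ⊆ B
    · have hf : (Sᶜ.filter fun x => insert x S ⊆ B) = B \ S := by
        ext x
        simp only [mem_filter, mem_compl, mem_sdiff, insert_subset_iff]
        tauto
      rw [← Finset.sum_filter, hf, Finset.sum_const, if_pos hSB, card_sdiff_of_subset hSB,
        nsmul_eq_mul, Nat.cast_sub (card_le_card hSB), (mem_filter.1 hB).2]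
    · rw [if_neg hSB, mul_zero]
      exact Finset.sum_eq_zero fun x _ =>
        if_neg fun hx => hSB ((subset_insert x S).trans hx)


open Finset

/-- **Matroids are 0-local spectral expanders.**
Let `ℐ` be a matroid on a finite ground set (nonempty, downward closed, satisfying the
exchange axiom), `N S` the number of bases containing `S`, and `I` an independent set.
Then for every `f` with `∑_{x∉I} N(I∪{x})·f(x) = 0`, the ordered-pair sum
`∑_{x≠y, x,y∉I} N(I∪{x,y})·f(x)·f(y)` is nonpositive. -/
theorem matroid_link_zero_expander {α : Type*} [Fintype α] [DecidableEq α]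
    (ℐ : Finset (Finset α)) (hne : ℐ.Nonempty)
    (hdown : ∀ T ∈ ℐ, ∀ S ⊆ T, S ∈ ℐ)
    (hexch : ∀ T₁ ∈ ℐ, ∀ T₂ ∈ ℐ, T₂.card < T₁.card → ∃ i ∈ T₁ \ T₂, insert i T₂ ∈ ℐ)
    (N : Finset α → ℕ)
    (hN : ∀ S : Finset α,
      N S = (ℐ.filter (fun B => (∀ T ∈ ℐ, B ⊆ T → B = T) ∧ S ⊆ B)).card)
    (I : Finset α) (hI : I ∈ ℐ)
    (f : α → ℝ)
    (hf : ∑ x ∈ Iᶜ, (N (insert x I) : ℝ) * f x = 0) :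
    ∑ x ∈ Iᶜ, ∑ y ∈ Iᶜ,
      (if x ≠ y then (N (insert x (insert y I)) : ℝ) * f x * f y else 0) ≤ 0 := by
  obtain ⟨r, hr⟩ := isBasisCount_card_filter ℐ hne hdown hexch
  simp only [← hN] at hr
  have key := hr.quadForm_nonpos hI f (by
    refine Eq.trans ?_ hf
    rw [← Finset.sum_subset (subset_univ Iᶜ) fun x _ hx => by
      rw [mem_compl, not_not] at hx
      simp [linkDegree, hx]]
    refine Finset.sum_congr rfl fun x hx => ?_
    rw [mem_compl] at hx
    rw [linkDegree, if_pos hx])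
  refine le_of_eq_of_le ?_ key
  rw [← Finset.sum_subset (subset_univ Iᶜ) fun x _ hx => by
    rw [mem_compl, not_not] at hx
    simp [linkWeight, hx]]
  refine Finset.sum_congr rfl fun x hx => ?_
  rw [← Finset.sum_subset (subset_univ Iᶜ) fun y _ hy => by
    rw [mem_compl, not_not] at hy
    simp [linkWeight, hy]]
  refine Finset.sum_congr rfl fun y hy => ?_
  rw [mem_compl] at hx hy
  simp [linkWeight, hx, hy, ite_mul]
end

section
/- Spectral gap of the base exchange walk (resolution of the Mihail–Vazirani conjecture). Let M be a matroid of rank r ≥ 1 on a finite ground set E, and for S ⊆ E let N(S) denote the number of bases of M containing S. Define the base exchange walk P on the set of bases of M by P(B,B') = (1/r) · ∑_{x ∈ B, B∖{x} ⊆ B'} 1/N(B∖{x}). Then the second-largest eigenvalue of P is at most 1 − 1/r: for every f : {bases of M} → ℝ with ∑_B f(B) = 0, it holds that ∑_{B,B'} f(B)·P(B,B')·f(B') ≤ (1 − 1/r) · ∑_B f(B)². -/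
open Finset
open Matrix

/-- A real matrix satisfies the reverse Cauchy–Schwarz inequality against the all-ones vector. -/
def ReverseCauchySchwarz {ι : Type*} [Fintype ι] (A : Matrix ι ι ℝ) : Prop :=
  ∀ g : ι → ℝ, (1 ⬝ᵥ A *ᵥ 1) * (g ⬝ᵥ A *ᵥ g) ≤ (1 ⬝ᵥ A *ᵥ g) ^ 2

theorem Matrix.IsSymm.dotProduct_mulVec_comm {ι : Type*} [Fintype ι] {A : Matrix ι ι ℝ}
    (hA : A.IsSymm) (u v : ι → ℝ) : u ⬝ᵥ A *ᵥ v = v ⬝ᵥ A *ᵥ u := by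
  rw [dotProduct_mulVec, ← mulVec_transpose, hA.eq, dotProduct_comm]

theorem ReverseCauchySchwarz.of_shift {ι : Type*} [Fintype ι] {A : Matrix ι ι ℝ}
    (hA : A.IsSymm) (h0 : 0 ≤ 1 ⬝ᵥ A *ᵥ 1)
    (h : 1 ⬝ᵥ A *ᵥ 1 ≠ 0 → ∀ g : ι → ℝ, ∃ t : ℝ, (g - t • 1) ⬝ᵥ A *ᵥ (g - t • 1) ≤ 0) :
    ReverseCauchySchwarz A := by
  intro g
  by_cases hz : 1 ⬝ᵥ A *ᵥ 1 = 0
  · rw [hz, zero_mul]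
    positivity
  obtain ⟨t, ht⟩ := h hz g
  simp only [mulVec_sub, mulVec_smul, dotProduct_sub, sub_dotProduct, smul_dotProduct,
    dotProduct_smul, smul_eq_mul, hA.dotProduct_mulVec_comm g 1] at ht
  have := mul_le_mul_of_nonneg_left ht h0
  nlinarith [sq_nonneg (1 ⬝ᵥ A *ᵥ g - t * (1 ⬝ᵥ A *ᵥ 1))]

/-- Adjacency matrices of complete multipartite graphs (with isolated vertices). -/
theorem ReverseCauchySchwarz.of_multipartite {ι : Type*} [Fintype ι] [DecidableEq ι]
    {A : Matrix ι ι ℝ} (hA : A.IsSymm) (h01 : ∀ x y, A x y = 0 ∨ A x y = 1)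
    (hdiag : ∀ x, A x x = 0)
    (hconn : ∀ x y z, A x z ≠ 0 → (A *ᵥ 1) y ≠ 0 → A x y ≠ 0 ∨ A z y ≠ 0) :
    ReverseCauchySchwarz A := by
  classical
  have hnn : ∀ x y, 0 ≤ A x y := fun x y => by rcases h01 x y with h | h <;> simp [h]
  have hd : ∀ x, (A *ᵥ 1) x = ∑ y, A x y := fun x => by simp [mulVec, dotProduct]
  have hd0 : ∀ x, (A *ᵥ 1) x = 0 → ∀ y, A x y = 0 := fun x hx y =>
    (Finset.sum_eq_zero_iff_of_nonneg (fun y _ => hnn x y)).1 (hd x ▸ hx) y (mem_univ y)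
  refine .of_shift hA ?_ ?_
  · simp only [dotProduct, hd]
    exact sum_nonneg fun x _ => mul_nonneg zero_le_one (sum_nonneg fun y _ => hnn x y)
  intro hne g
  set V : Finset ι := univ.filter fun x => (A *ᵥ 1) x ≠ 0 with hV
  have hVne : (V.card : ℝ) ≠ 0 := by
    intro h
    apply hne
    have hVe : V = ∅ := by simpa using h
    refine sum_eq_zero fun x _ => ?_
    have : x ∉ V := by simp [hVe]
    simp only [hV, mem_filter, mem_univ, true_and, not_not] at this
    simp [this]
  set c : ι → Finset ι := fun x => V.filter fun y => A x y = 0 with hc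
  have hsub : ∀ x ∈ V, ∀ y, A x y = 0 → c x ⊆ c y := by
    intro x hx y hxy z hz
    simp only [hc, mem_filter] at hz ⊢
    refine ⟨hz.1, ?_⟩
    by_contra hyz
    rcases hconn y x z hyz (by simpa [hV] using hx) with h | h
    · exact h ((hA.apply x y).symm ▸ hxy)
    · exact h ((hA.apply x z).symm ▸ hz.2)
  have hcc : ∀ x ∈ V, ∀ y ∈ V, (A x y = 0 ↔ c x = c y) := by
    intro x hx y hy
    constructor
    · intro h
      exact (hsub x hx y h).antisymm (hsub y hy x ((hA.apply x y).trans h))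
    · intro h
      have : y ∈ c y := by simp [hc, hy, hdiag]
      rw [← h] at this
      exact (mem_filter.1 this).2
  have hform : ∀ x y, A x y =
      if x ∈ V ∧ y ∈ V then 1 - (if c x = c y then 1 else 0) else 0 := by
    intro x y
    split_ifs with h1 h2
    · simpa using (hcc x h1.1 y h1.2).2 h2
    · have := mt (hcc x h1.1 y h1.2).1 h2
      rcases h01 x y with h | h
      · exact absurd h this
      · simp [h]
    · by_cases hx : x ∈ V
      · have hy : y ∉ V := fun hy => h1 ⟨hx, hy⟩
        rw [← hA.apply]
        exact hd0 y (by simpa [hV] using hy) x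
      · exact hd0 x (by simpa [hV] using hx) y
  have hquad : ∀ u : ι → ℝ, u ⬝ᵥ A *ᵥ u =
      (∑ x ∈ V, u x) ^ 2 - ∑ k ∈ V.image c, (∑ x ∈ V with c x = k, u x) ^ 2 := by
    intro u
    have e1 : u ⬝ᵥ A *ᵥ u =
        ∑ x ∈ V, ∑ y ∈ V, (u x * u y - if c x = c y then u x * u y else 0) := by
      simp only [dotProduct, mulVec, mul_sum]
      rw [← sum_subset (subset_univ V)]
      · refine sum_congr rfl fun x hx => ?_
        rw [← sum_subset (subset_univ V)]
        · refine sum_congr rfl fun y hy => ?_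
          rw [hform, if_pos ⟨hx, hy⟩]
          split_ifs <;> ring
        · intro y _ hy
          simp [hform x y, hy]
      · intro x _ hx
        refine sum_eq_zero fun y _ => ?_
        simp [hform x y, hx]
    rw [e1]
    simp only [sum_sub_distrib]
    congr 1
    · rw [sq, sum_mul_sum]
    · rw [← sum_fiberwise_of_maps_to (s := V) (t := V.image c) (g := c)
        (fun x hx => mem_image_of_mem c hx)]
      refine sum_congr rfl fun k _ => ?_
      rw [sq, sum_mul_sum]
      refine sum_congr rfl fun x hx => ?_
      rw [← sum_filter, (mem_filter.1 hx).2]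
      simp only [eq_comm]
  refine ⟨(∑ x ∈ V, g x) / V.card, ?_⟩
  rw [hquad]
  have : ∑ x ∈ V, (g - ((∑ x ∈ V, g x) / V.card) • 1) x = 0 := by
    simp only [Pi.sub_apply, Pi.smul_apply, Pi.one_apply, smul_eq_mul, mul_one, sum_sub_distrib,
      sum_const, nsmul_eq_mul]
    field_simp
    simp
  rw [this]
  have := sum_nonneg fun k (_ : k ∈ V.image c) =>
    sq_nonneg (∑ x ∈ V with c x = k, (g - ((∑ x ∈ V, g x) / V.card) • 1) x)
  linarith

/-- A symmetric form is nonpositive at a vector orthogonal to all eigenvectors of positive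
eigenvalue. -/
theorem Matrix.IsSymm.dotProduct_mulVec_nonpos {ι : Type*} [Fintype ι]
    {B : Matrix ι ι ℝ} (hB : B.IsSymm) (h : ι → ℝ)
    (horth : ∀ (μ : ℝ) (u : ι → ℝ), B *ᵥ u = μ • u → u ⬝ᵥ u = 1 → 0 < μ → u ⬝ᵥ h = 0) :
    h ⬝ᵥ B *ᵥ h ≤ 0 := by
  classical
  have hH : B.IsHermitian := by
    rw [Matrix.IsHermitian, conjTranspose_eq_transpose_of_trivial]
    exact hB
  have key := hH.eigenvectorBasis.sum_inner_mul_inner (WithLp.toLp 2 h) (WithLp.toLp 2 (B *ᵥ h))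
  simp only [EuclideanSpace.inner_eq_star_dotProduct, star_trivial] at key
  rw [dotProduct_comm, ← key]
  refine sum_nonpos fun i _ => ?_
  set u : ι → ℝ := (hH.eigenvectorBasis i).ofLp with hu
  have hev : B *ᵥ u = hH.eigenvalues i • u := hH.mulVec_eigenvectorBasis i
  have hun : u ⬝ᵥ u = 1 := by
    have := hH.eigenvectorBasis.orthonormal.1 i
    have h2 := real_inner_self_eq_norm_sq (hH.eigenvectorBasis i)
    rw [this, EuclideanSpace.inner_eq_star_dotProduct, star_trivial] at h2
    simpa using h2
  rw [dotProduct_comm (B *ᵥ h) u, hB.dotProduct_mulVec_comm u h, hev, dotProduct_smul,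
    smul_eq_mul, dotProduct_comm h u]
  rcases le_or_gt (hH.eigenvalues i) 0 with h0 | h0
  · nlinarith [mul_self_nonneg (u ⬝ᵥ h)]
  · simp [horth _ u hev hun h0]

/-- Oppenheim's trickling-down argument. -/
theorem ReverseCauchySchwarz.of_trickle {ι : Type*} [Fintype ι] {A : Matrix ι ι ℝ}
    (hA : A.IsSymm) (hnn : ∀ x y, 0 ≤ A x y)
    (hconn : ∀ x y z, A x z ≠ 0 → (A *ᵥ 1) y ≠ 0 → A x y ≠ 0 ∨ A z y ≠ 0)
    (htr : ∀ g : ι → ℝ, g ⬝ᵥ A *ᵥ g ≤ ∑ z, (A *ᵥ g) z ^ 2 / (A *ᵥ 1) z) :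
    ReverseCauchySchwarz A := by
  classical
  set d : ι → ℝ := A *ᵥ 1 with hdd
  have hd : ∀ x, d x = ∑ y, A x y := fun x => by simp [hdd, mulVec, dotProduct]
  have hdnn : ∀ x, 0 ≤ d x := fun x => hd x ▸ sum_nonneg fun y _ => hnn x y
  have hd0 : ∀ x, d x = 0 → ∀ y, A x y = 0 := fun x hx y =>
    (Finset.sum_eq_zero_iff_of_nonneg (fun y _ => hnn x y)).1 (hd x ▸ hx) y (mem_univ y)
  have hdex : ∀ x, d x ≠ 0 → ∃ y, A x y ≠ 0 := by
    intro x hx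
    by_contra! h
    exact hx (by simp [hd, h])
  refine .of_shift hA ?_ ?_
  · exact sum_nonneg fun x _ => mul_nonneg zero_le_one (hdnn x)
  intro hne g
  set t := (1 ⬝ᵥ A *ᵥ g) / (1 ⬝ᵥ A *ᵥ 1) with ht
  refine ⟨t, ?_⟩
  have hort : (g - t • 1) ⬝ᵥ d = 0 := by
    rw [hdd, sub_dotProduct, smul_dotProduct, hA.dotProduct_mulVec_comm g 1, smul_eq_mul, ht,
      div_mul_cancel₀ _ hne, sub_self]
  generalize g - t • 1 = g at hort
  set s : ι → ℝ := fun x => √(d x) with hs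
  have hss : ∀ x, s x * s x = d x := fun x => Real.mul_self_sqrt (hdnn x)
  have hs0 : ∀ x, s x = 0 ↔ d x = 0 := fun x => Real.sqrt_eq_zero (hdnn x)
  set B : Matrix ι ι ℝ := of fun x y => A x y / (s x * s y) with hB
  have hBs : B.IsSymm := by
    ext x y
    simp [hB, transpose_apply, hA.apply x y, mul_comm]
  have hBv : ∀ (u : ι → ℝ) x, (B *ᵥ u) x = (A *ᵥ (u / s)) x / s x := by
    intro u x
    simp only [hB, mulVec, dotProduct, of_apply, Pi.div_apply, sum_div]
    refine sum_congr rfl fun y _ => ?_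
    rw [mul_div_assoc', div_div, mul_comm (s y), div_mul_eq_mul_div]
  have hBq : ∀ u : ι → ℝ, u ⬝ᵥ B *ᵥ u = (u / s) ⬝ᵥ A *ᵥ (u / s) := by
    intro u
    refine sum_congr rfl fun x _ => ?_
    rw [hBv, Pi.div_apply]
    ring
  have hgq : g ⬝ᵥ A *ᵥ g = (g * s) ⬝ᵥ B *ᵥ (g * s) := by
    rw [hBq]
    have hAe : A *ᵥ (g * s / s) = A *ᵥ g := by
      ext x
      refine sum_congr rfl fun y _ => ?_
      by_cases hy : s y = 0
      · have : A x y = 0 := (hA.apply x y).symm.trans (hd0 y ((hs0 y).1 hy) x)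
        simp [this]
      · simp [mul_div_cancel_right₀ _ hy]
    rw [hAe]
    refine sum_congr rfl fun x _ => ?_
    by_cases hx : s x = 0
    · simp [mulVec, dotProduct, hd0 x ((hs0 x).1 hx)]
    · simp [mul_div_cancel_right₀ _ hx]
  rw [hgq]
  refine hBs.dotProduct_mulVec_nonpos _ fun μ u hev hun hμ => ?_
  have hμ1 : 1 ≤ μ := by
    have h1 := htr (u / s)
    have h2 : ∑ z, (A *ᵥ (u / s)) z ^ 2 / d z = (B *ᵥ u) ⬝ᵥ (B *ᵥ u) := by
      refine sum_congr rfl fun x _ => ?_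
      rw [hBv, ← hss, div_mul_div_comm, sq]
    rw [h2, ← hBq, hev, dotProduct_smul, smul_dotProduct, dotProduct_smul, hun] at h1
    simp only [smul_eq_mul, mul_one] at h1
    exact le_of_mul_le_mul_left (by linarith) hμ
  set v := u / s with hv
  have hvq : 1 ≤ v ⬝ᵥ A *ᵥ v := by
    rw [← hBq, hev, dotProduct_smul, hun]
    simpa using hμ1
  have hvd : ∑ x, d x * v x ^ 2 ≤ 1 := by
    rw [← hun]
    refine sum_le_sum fun x _ => ?_
    rw [← hss, hv, Pi.div_apply]
    by_cases hx : s x = 0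
    · simp [hx, mul_self_nonneg]
    · apply le_of_eq
      field_simp
  have hdir : ∑ x, ∑ y, A x y * (v x - v y) ^ 2 ≤ 0 := by
    have e1 : ∑ x, ∑ y, A x y * v x ^ 2 = ∑ x, d x * v x ^ 2 := by
      simp only [hd, sum_mul]
    have e2 : ∑ x, ∑ y, A x y * v y ^ 2 = ∑ x, d x * v x ^ 2 := by
      rw [sum_comm, ← e1]
      exact sum_congr rfl fun x _ => sum_congr rfl fun y _ => by rw [hA.apply]
    have e3 : ∑ x, ∑ y, A x y * (v x * v y) = v ⬝ᵥ A *ᵥ v := by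
      simp only [dotProduct, mulVec, mul_sum]
      exact sum_congr rfl fun x _ => sum_congr rfl fun y _ => by ring
    have : ∑ x, ∑ y, A x y * (v x - v y) ^ 2 =
        ∑ x, ∑ y, A x y * v x ^ 2 + ∑ x, ∑ y, A x y * v y ^ 2
          - 2 * ∑ x, ∑ y, A x y * (v x * v y) := by
      simp only [mul_sum, ← sum_add_distrib, ← sum_sub_distrib]
      exact sum_congr rfl fun x _ => sum_congr rfl fun y _ => by ring
    rw [this, e1, e2, e3]
    linarith
  have hnn2 : ∀ x y, 0 ≤ A x y * (v x - v y) ^ 2 := fun x y => mul_nonneg (hnn x y) (sq_nonneg _)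
  have hadj : ∀ x y, A x y ≠ 0 → v x = v y := by
    intro x y hxy
    have h1 := hdir.antisymm (sum_nonneg fun x _ => sum_nonneg fun y _ => hnn2 x y)
    rw [sum_eq_zero_iff_of_nonneg fun x _ => sum_nonneg fun y _ => hnn2 x y] at h1
    have h2 := (sum_eq_zero_iff_of_nonneg fun y _ => hnn2 x y).1 (h1 x (mem_univ x)) y (mem_univ y)
    have h3 := (mul_eq_zero.1 h2).resolve_left hxy
    exact sub_eq_zero.1 (pow_eq_zero_iff two_ne_zero |>.1 h3)
  have hconst : ∃ c, ∀ x, d x ≠ 0 → v x = c := by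
    by_cases hex : ∃ x, d x ≠ 0
    · obtain ⟨x, hx⟩ := hex
      refine ⟨v x, fun y hy => ?_⟩
      obtain ⟨z, hz⟩ := hdex x hx
      rcases hconn x y z hz hy with h | h
      · exact (hadj x y h).symm
      · exact ((hadj x z hz).trans (hadj z y h)).symm
    · push Not at hex
      exact ⟨0, fun x hx => absurd (hex x) hx⟩
  obtain ⟨c, hc⟩ := hconst
  have hus : ∀ x, u x = c * s x := by
    intro x
    by_cases hx : s x = 0
    · have h1 := congrFun hev x
      rw [hBv, hx, div_zero, Pi.smul_apply, smul_eq_mul] at h1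
      rw [hx, mul_zero]
      exact (mul_eq_zero.1 h1.symm).resolve_left hμ.ne'
    · rw [← hc x (mt (hs0 x).2 hx), hv, Pi.div_apply, div_mul_cancel₀ _ hx]
  have : u ⬝ᵥ (g * s) = c * (g ⬝ᵥ d) := by
    simp only [dotProduct, mul_sum]
    refine sum_congr rfl fun x _ => ?_
    rw [hus, ← hss, Pi.mul_apply]
    ring
  rw [this, hort, mul_zero]

/-- Double counting of pairs `x ∈ T \ S` over the members `T ⊇ S` of a uniform family. -/
theorem sum_compl_sum_insert_subset {α : Type*} [Fintype α] [DecidableEq α]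
    {𝓕 : Finset (Finset α)} {n : ℕ} (hn : ∀ T ∈ 𝓕, T.card = n) (φ : Finset α → ℝ)
    (S : Finset α) :
    ∑ x ∈ Sᶜ, ∑ T ∈ 𝓕 with insert x S ⊆ T, φ T =
      ((n : ℝ) - S.card) * ∑ T ∈ 𝓕 with S ⊆ T, φ T := by
  simp only [sum_filter, mul_sum]
  rw [sum_comm]
  refine sum_congr rfl fun T hT => ?_
  by_cases hST : S ⊆ T
  · have h1 : ∑ x ∈ Sᶜ, (if insert x S ⊆ T then φ T else 0) = ∑ x ∈ T \ S, φ T := by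
      rw [← sum_filter]
      refine sum_congr ?_ fun _ _ => rfl
      ext x
      simp [insert_subset_iff, hST, and_comm]
    rw [h1, if_pos hST, sum_const, card_sdiff_of_subset hST, hn T hT, nsmul_eq_mul,
      Nat.cast_sub (hn T hT ▸ card_le_card hST)]
  · rw [if_neg hST, mul_zero]
    refine sum_eq_zero fun x _ => if_neg fun h => hST ((subset_insert x S).trans h)

/-- Weights of the vertices of the link of `S`. -/
def linkVec {α : Type*} [DecidableEq α] (w : Finset α → ℝ) (S : Finset α) (x : α) : ℝ :=
  if x ∈ S then 0 else w (insert x S)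

/-- Weighted adjacency matrix of the link of `S`. -/
def linkMatrix {α : Type*} [DecidableEq α] (w : Finset α → ℝ) (S : Finset α) : Matrix α α ℝ :=
  of fun x y => if x ∈ S ∨ y ∈ S ∨ x = y then 0 else w (insert x (insert y S))

section Link

variable {α : Type*} [DecidableEq α] {w : Finset α → ℝ} {r : ℕ}

theorem linkMatrix_apply (S : Finset α) (x y : α) :
    linkMatrix w S x y = if x ∈ S ∨ y ∈ S ∨ x = y then 0 else w (insert x (insert y S)) := rfl

theorem linkMatrix_apply_eq_linkVec (S : Finset α) (x y : α) :
    linkMatrix w S x y = if x ∈ S then 0 else linkVec w (insert x S) y := by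
  rw [linkMatrix_apply, linkVec, insert_comm]
  by_cases hx : x ∈ S <;> simp [hx, or_comm, eq_comm]

theorem linkMatrix_isSymm (S : Finset α) : (linkMatrix w S).IsSymm := by
  ext x y
  rw [transpose_apply, linkMatrix_apply, linkMatrix_apply, insert_comm]
  refine if_congr ?_ rfl rfl
  rw [or_left_comm, @eq_comm _ x y]

theorem linkMatrix_nonneg (hw0 : ∀ S, 0 ≤ w S) (S : Finset α) (x y : α) :
    0 ≤ linkMatrix w S x y := by
  rw [linkMatrix_apply]
  split_ifs
  exacts [le_rfl, hw0 _]

variable [Fintype α]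

theorem sum_linkVec_mul (S : Finset α) (g : α → ℝ) :
    ∑ x, linkVec w S x * g x = ∑ x ∈ Sᶜ, w (insert x S) * g x := by
  rw [← sum_subset (subset_univ Sᶜ)]
  · exact sum_congr rfl fun x hx => by rw [linkVec, if_neg (mem_compl.1 hx)]
  · intro x _ hx
    rw [linkVec, if_pos (by simpa using hx), zero_mul]

theorem sum_linkVec (hw : ∀ S, ∑ z ∈ Sᶜ, w (insert z S) = ((r : ℝ) - S.card) * w S)
    (S : Finset α) : ∑ x, linkVec w S x = ((r : ℝ) - S.card) * w S := by
  simpa [hw] using sum_linkVec_mul (w := w) S 1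

theorem linkMatrix_mulVec_apply {S : Finset α} {x : α} (hx : x ∉ S) (g : α → ℝ) :
    (linkMatrix w S *ᵥ g) x = ∑ y, linkVec w (insert x S) y * g y := by
  simp [mulVec, dotProduct, linkMatrix_apply_eq_linkVec, hx]

theorem linkMatrix_mulVec_one (hw : ∀ S, ∑ z ∈ Sᶜ, w (insert z S) = ((r : ℝ) - S.card) * w S)
    (S : Finset α) (x : α) :
    (linkMatrix w S *ᵥ 1) x = ((r : ℝ) - S.card - 1) * linkVec w S x := by
  by_cases hx : x ∈ S
  · simp [mulVec, dotProduct, linkMatrix_apply, linkVec, hx]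
  · rw [linkMatrix_mulVec_apply hx]
    simp only [Pi.one_apply, mul_one]
    rw [sum_linkVec hw, card_insert_of_notMem hx, linkVec, if_neg hx]
    push_cast
    ring

theorem one_dotProduct_linkMatrix_mulVec
    (hw : ∀ S, ∑ z ∈ Sᶜ, w (insert z S) = ((r : ℝ) - S.card) * w S)
    (S : Finset α) (g : α → ℝ) :
    1 ⬝ᵥ linkMatrix w S *ᵥ g = ((r : ℝ) - S.card - 1) * ∑ x, linkVec w S x * g x := by
  rw [(linkMatrix_isSymm S).dotProduct_mulVec_comm, dotProduct, mul_sum]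
  refine sum_congr rfl fun x _ => ?_
  rw [linkMatrix_mulVec_one hw]
  ring

theorem sum_linkMatrix_insert (hw : ∀ S, ∑ z ∈ Sᶜ, w (insert z S) = ((r : ℝ) - S.card) * w S)
    (S : Finset α) (x y : α) :
    ∑ z ∈ Sᶜ, linkMatrix w (insert z S) x y =
      ((r : ℝ) - S.card - 2) * linkMatrix w S x y := by
  by_cases h : x ∈ S ∨ y ∈ S ∨ x = y
  · rw [linkMatrix_apply, if_pos h, mul_zero]
    refine sum_eq_zero fun z _ => ?_
    rw [linkMatrix_apply, if_pos]
    simp only [mem_insert]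
    tauto
  · rw [linkMatrix_apply, if_neg h]
    push Not at h
    obtain ⟨hx, hy, hxy⟩ := h
    have hc : (insert x (insert y S)).card = S.card + 2 := by
      rw [card_insert_of_notMem (by simp [hx, hxy]), card_insert_of_notMem hy]
    have h1 := hw (insert x (insert y S))
    rw [hc] at h1
    push_cast at h1
    rw [sub_sub, ← h1]
    symm
    rw [← sum_subset (s₂ := Sᶜ)]
    · refine sum_congr rfl fun z hz => ?_
      simp only [mem_compl, mem_insert, not_or] at hz
      rw [linkMatrix_apply, if_neg, insert_comm y z, insert_comm x z]
      simp only [mem_insert, not_or]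
      exact ⟨⟨Ne.symm hz.1, hx⟩, ⟨Ne.symm hz.2.1, hy⟩, hxy⟩
    · exact compl_subset_compl.2 ((subset_insert y S).trans (subset_insert x _))
    · intro z hz hz2
      rw [linkMatrix_apply, if_pos]
      simp only [mem_compl, mem_insert, not_not] at hz hz2 ⊢
      tauto

/-- Local-to-global principle: if all links are connected and the links of corank two satisfy the
reverse Cauchy–Schwarz inequality, then so do all links. -/
theorem reverseCauchySchwarz_linkMatrix (hw0 : ∀ S, 0 ≤ w S)
    (hw : ∀ S, ∑ z ∈ Sᶜ, w (insert z S) = ((r : ℝ) - S.card) * w S)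
    (hconn : ∀ S : Finset α, S.card + 2 ≤ r → ∀ x y z, linkMatrix w S x z ≠ 0 →
      (linkMatrix w S *ᵥ 1) y ≠ 0 → linkMatrix w S x y ≠ 0 ∨ linkMatrix w S z y ≠ 0)
    (hbase : ∀ S : Finset α, S.card + 2 = r → ReverseCauchySchwarz (linkMatrix w S))
    (k : ℕ) : ∀ S : Finset α, S.card + 2 + k = r → ReverseCauchySchwarz (linkMatrix w S) := by
  induction k with
  | zero => exact fun S hS => hbase S hS
  | succ k ih =>
    intro S hS
    refine .of_trickle (linkMatrix_isSymm S) (linkMatrix_nonneg hw0 S)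
      (hconn S (by omega)) fun g => ?_
    have hk : (r : ℝ) = S.card + 2 + (k + 1) := by exact_mod_cast hS.symm
    have hk0 : (0 : ℝ) ≤ k := k.cast_nonneg
    have hsum : ∑ z ∈ Sᶜ, g ⬝ᵥ linkMatrix w (insert z S) *ᵥ g =
        (k + 1) * (g ⬝ᵥ linkMatrix w S *ᵥ g) := by
      have h1 : ∀ T : Finset α, g ⬝ᵥ linkMatrix w T *ᵥ g =
          ∑ x, ∑ y, linkMatrix w T x y * (g x * g y) := fun T => by
        simp only [dotProduct, mulVec, mul_sum]
        exact sum_congr rfl fun x _ => sum_congr rfl fun y _ => by ring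
      simp only [h1]
      rw [sum_comm, mul_sum]
      refine sum_congr rfl fun x _ => ?_
      rw [sum_comm, mul_sum]
      refine sum_congr rfl fun y _ => ?_
      rw [← sum_mul, sum_linkMatrix_insert hw, hk]
      ring
    have hterm : ∀ z ∈ Sᶜ, g ⬝ᵥ linkMatrix w (insert z S) *ᵥ g ≤
        (k + 1) * ((linkMatrix w S *ᵥ g) z ^ 2 / (linkMatrix w S *ᵥ 1) z) := by
      intro z hz
      rw [mem_compl] at hz
      have hc : ((insert z S).card : ℝ) = S.card + 1 := by
        rw [card_insert_of_notMem hz]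
        push_cast
        rfl
      have h1 := ih (insert z S) (by rw [card_insert_of_notMem hz]; omega) g
      rw [one_dotProduct_linkMatrix_mulVec hw, one_dotProduct_linkMatrix_mulVec hw,
        ← linkMatrix_mulVec_apply hz g] at h1
      simp only [Pi.one_apply, mul_one] at h1
      rw [sum_linkVec hw, hc, hk] at h1
      rw [linkMatrix_mulVec_one hw, linkVec, if_neg hz, hk]
      rcases (hw0 (insert z S)).eq_or_lt with h0 | h0
      · have hvec : ∀ y, (linkMatrix w (insert z S) *ᵥ 1) y = 0 := by
          have h2 : ∑ y, linkVec w (insert z S) y = 0 := by rw [sum_linkVec hw, ← h0, mul_zero]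
          have h3 : ∀ y, 0 ≤ linkVec w (insert z S) y := fun y => by
            rw [linkVec]
            split_ifs
            exacts [le_rfl, hw0 _]
          intro y
          rw [linkMatrix_mulVec_one hw,
            (sum_eq_zero_iff_of_nonneg fun y _ => h3 y).1 h2 y (mem_univ y), mul_zero]
        have hzero : ∀ x y, linkMatrix w (insert z S) x y = 0 := by
          intro x y
          have h2 := hvec x
          simp only [mulVec, dotProduct, Pi.one_apply, mul_one] at h2
          exact (sum_eq_zero_iff_of_nonneg fun y _ => linkMatrix_nonneg hw0 _ x y).1 h2 y
            (mem_univ y)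
        rw [← h0]
        simp [dotProduct, mulVec, hzero]
      · set q := g ⬝ᵥ linkMatrix w (insert z S) *ᵥ g
        set a := (linkMatrix w S *ᵥ g) z
        rw [mul_div_assoc', le_div_iff₀ (mul_pos (by linarith) h0)]
        refine le_of_mul_le_mul_left ?_ (show (0 : ℝ) < k + 1 by positivity)
        linarith
    refine le_of_mul_le_mul_left ?_ (show (0 : ℝ) < k + 1 by positivity)
    rw [← hsum, mul_sum]
    refine (sum_le_sum hterm).trans (le_of_eq (sum_subset (subset_univ _) fun z _ hz => ?_))
    rw [linkMatrix_mulVec_one hw, linkVec, if_pos (by simpa using hz)]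
    simp

end Link

section Variance

variable {α : Type*} [DecidableEq α] (𝓑 : Finset (Finset α))

/-- The number of members of a family containing `S`. -/
def upCount (S : Finset α) : ℝ := ((𝓑.filter fun B => S ⊆ B).card : ℝ)

/-- The unnormalized variance of `f` over the members of a family containing `S`. -/
noncomputable def upVar (f : Finset α → ℝ) (S : Finset α) : ℝ :=
  ∑ B ∈ 𝓑 with S ⊆ B, f B ^ 2 - (∑ B ∈ 𝓑 with S ⊆ B, f B) ^ 2 / upCount 𝓑 S

variable {𝓑}

theorem upCount_ne_zero {S : Finset α} : upCount 𝓑 S ≠ 0 ↔ ∃ B ∈ 𝓑, S ⊆ B := by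
  simp [upCount, Finset.filter_eq_empty_iff]

theorem upVar_sub_const (f : Finset α → ℝ) (c : ℝ) (S : Finset α) :
    upVar 𝓑 (fun B => f B - c) S = upVar 𝓑 f S := by
  have h1 : ∑ B ∈ 𝓑 with S ⊆ B, (f B - c) = ∑ B ∈ 𝓑 with S ⊆ B, f B - upCount 𝓑 S * c := by
    rw [sum_sub_distrib, sum_const, nsmul_eq_mul, upCount]
  have h2 : ∑ B ∈ 𝓑 with S ⊆ B, (f B - c) ^ 2 = ∑ B ∈ 𝓑 with S ⊆ B, f B ^ 2
      - 2 * c * ∑ B ∈ 𝓑 with S ⊆ B, f B + upCount 𝓑 S * c ^ 2 := by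
    rw [upCount, ← nsmul_eq_mul, ← sum_const, mul_sum, ← sum_sub_distrib, ← sum_add_distrib]
    exact sum_congr rfl fun B _ => by ring
  rw [upVar, upVar, h1, h2]
  by_cases h0 : upCount 𝓑 S = 0
  · have : (𝓑.filter fun B => S ⊆ B) = ∅ := by simpa [upCount] using h0
    simp [h0, this]
  · field_simp
    ring

variable [Fintype α] {r : ℕ}

theorem sum_upCount_insert (hr : ∀ B ∈ 𝓑, B.card = r) (S : Finset α) :
    ∑ z ∈ Sᶜ, upCount 𝓑 (insert z S) = ((r : ℝ) - S.card) * upCount 𝓑 S := by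
  simpa [upCount] using sum_compl_sum_insert_subset hr (fun _ => 1) S

theorem mul_upVar_le_sum_upVar_insert (hr : ∀ B ∈ 𝓑, B.card = r) {S : Finset α}
    (hS : S.card + 2 ≤ r) (hA : ReverseCauchySchwarz (linkMatrix (upCount 𝓑) S))
    (f : Finset α → ℝ) :
    ((r : ℝ) - S.card - 1) * upVar 𝓑 f S ≤ ∑ x ∈ Sᶜ, upVar 𝓑 f (insert x S) := by
  by_cases h0 : upCount 𝓑 S = 0
  · have h1 : ∀ T, S ⊆ T → upVar 𝓑 f T = 0 := by
      intro T hT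
      have : (𝓑.filter fun B => T ⊆ B) = ∅ := by
        rw [filter_eq_empty_iff]
        intro B hB hTB
        exact upCount_ne_zero.2 ⟨B, hB, hT.trans hTB⟩ h0
      simp [upVar, this]
    rw [h1 S Subset.rfl, sum_eq_zero fun x _ => h1 _ (subset_insert x S), mul_zero]
  have hpos : 0 < upCount 𝓑 S := lt_of_le_of_ne (Nat.cast_nonneg _) (Ne.symm h0)
  have hmean : ∑ B ∈ 𝓑 with S ⊆ B,
      (f B - (∑ B ∈ 𝓑 with S ⊆ B, f B) / upCount 𝓑 S) = 0 := by
    rw [sum_sub_distrib, sum_const, nsmul_eq_mul]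
    change _ - upCount 𝓑 S * _ = 0
    rw [mul_div_cancel₀ _ h0, sub_self]
  simp only [← upVar_sub_const f ((∑ B ∈ 𝓑 with S ⊆ B, f B) / upCount 𝓑 S)]
  generalize (fun B => f B - (∑ B ∈ 𝓑 with S ⊆ B, f B) / upCount 𝓑 S) = f at hmean
  have hS' : (S.card : ℝ) + 2 ≤ r := by exact_mod_cast hS
  have hw := sum_upCount_insert hr
  set w := upCount 𝓑 with hwd
  set F : Finset α → ℝ := fun T => ∑ B ∈ 𝓑 with T ⊆ B, f B with hF
  have hF0 : ∀ T, w T = 0 → F T = 0 := by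
    intro T hT
    have : (𝓑.filter fun B => T ⊆ B) = ∅ := by simpa [hwd, upCount] using hT
    simp [hF, this]
  set g : α → ℝ := fun x => F (insert x S) / w (insert x S) with hg
  have hwg : ∀ x, w (insert x S) * g x = F (insert x S) := by
    intro x
    by_cases h : w (insert x S) = 0
    · rw [h, zero_mul, hF0 _ h]
    · exact mul_div_cancel₀ _ h
  have hlin : ∑ x, linkVec w S x * g x = 0 := by
    rw [sum_linkVec_mul]
    simp only [hwg]
    rw [hF, sum_compl_sum_insert_subset hr f S, hmean, mul_zero]
  have hq : g ⬝ᵥ linkMatrix w S *ᵥ g ≤ 0 := by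
    have h1 := hA g
    rw [one_dotProduct_linkMatrix_mulVec hw, one_dotProduct_linkMatrix_mulVec hw, hlin] at h1
    simp only [Pi.one_apply, mul_one] at h1
    rw [sum_linkVec hw] at h1
    refine nonpos_of_mul_nonpos_right (a := ((r : ℝ) - S.card - 1) * ((r - S.card) * w S))
      (by simpa using h1) ?_
    exact mul_pos (by linarith) (mul_pos (by linarith) hpos)
  have hswap : ∀ (x : α) (φ : Finset α → ℝ),
      ∑ B ∈ 𝓑 with S ⊆ B, (if x ∈ B then φ B else 0) = ∑ B ∈ 𝓑 with insert x S ⊆ B, φ B := by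
    intro x φ
    rw [← sum_filter, filter_filter]
    simp only [insert_subset_iff, and_comm]
  set G : Finset α → ℝ := fun B => ∑ x ∈ Sᶜ, if x ∈ B then g x else 0 with hG
  have hfG : ∑ B ∈ 𝓑 with S ⊆ B, f B * G B = ∑ x ∈ Sᶜ, g x * F (insert x S) := by
    simp only [hG, hF, mul_sum]
    rw [sum_comm]
    refine sum_congr rfl fun x _ => ?_
    rw [← hswap]
    refine sum_congr rfl fun B _ => ?_
    split_ifs <;> ring
  have hGG : ∑ B ∈ 𝓑 with S ⊆ B, G B ^ 2 =
      ∑ x ∈ Sᶜ, g x * F (insert x S) + g ⬝ᵥ linkMatrix w S *ᵥ g := by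
    have hpair : ∀ x ∈ Sᶜ, ∀ y ∈ Sᶜ, ∑ B ∈ 𝓑 with S ⊆ B,
        (if x ∈ B then g x else 0) * (if y ∈ B then g y else 0) =
          (if x = y then g x * F (insert x S) else 0) + g x * (linkMatrix w S x y * g y) := by
      intro x hx y hy
      rw [mem_compl] at hx hy
      have h1 : ∑ B ∈ 𝓑 with S ⊆ B, (if x ∈ B then g x else 0) * (if y ∈ B then g y else 0) =
          w (insert x (insert y S)) * (g x * g y) := by
        rw [hwd, upCount, ← nsmul_eq_mul, ← sum_const, sum_filter, sum_filter]
        refine sum_congr rfl fun B _ => ?_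
        simp only [insert_subset_iff]
        by_cases hxB : x ∈ B <;> by_cases hyB : y ∈ B <;> simp [hxB, hyB]
      rw [h1, linkMatrix_apply]
      by_cases hxy : x = y
      · subst hxy
        simp only [insert_idem, or_true, if_true, zero_mul, mul_zero, add_zero, ← hwg]
        ring
      · simp only [hx, hy, hxy, or_self, if_false]
        ring
    have hdot : g ⬝ᵥ linkMatrix w S *ᵥ g =
        ∑ x ∈ Sᶜ, ∑ y ∈ Sᶜ, g x * (linkMatrix w S x y * g y) := by
      simp only [dotProduct, mulVec, mul_sum]
      rw [← sum_subset (subset_univ Sᶜ)]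
      · refine sum_congr rfl fun x _ => (sum_subset (subset_univ Sᶜ) fun y _ hy => ?_).symm
        rw [mem_compl, not_not] at hy
        simp [linkMatrix_apply, hy]
      · intro x _ hx
        rw [mem_compl, not_not] at hx
        simp [linkMatrix_apply, hx]
    simp only [hG, sq, sum_mul_sum]
    rw [sum_comm, hdot, ← sum_add_distrib]
    refine sum_congr rfl fun x hx => ?_
    rw [sum_comm, sum_congr rfl fun y hy => hpair x hx y hy, sum_add_distrib, sum_ite_eq, if_pos hx]
  have hsq : 0 ≤ ∑ B ∈ 𝓑 with S ⊆ B, (f B - G B) ^ 2 := sum_nonneg fun B _ => sq_nonneg _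
  have hexp : ∑ B ∈ 𝓑 with S ⊆ B, (f B - G B) ^ 2 = ∑ B ∈ 𝓑 with S ⊆ B, f B ^ 2
      - 2 * ∑ B ∈ 𝓑 with S ⊆ B, f B * G B + ∑ B ∈ 𝓑 with S ⊆ B, G B ^ 2 := by
    rw [mul_sum, ← sum_sub_distrib, ← sum_add_distrib]
    exact sum_congr rfl fun B _ => by ring
  have hR : ∑ x ∈ Sᶜ, upVar 𝓑 f (insert x S) = ((r : ℝ) - S.card) * ∑ B ∈ 𝓑 with S ⊆ B, f B ^ 2
      - ∑ x ∈ Sᶜ, g x * F (insert x S) := by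
    rw [← sum_compl_sum_insert_subset hr (fun B => f B ^ 2) S, ← sum_sub_distrib]
    refine sum_congr rfl fun x _ => ?_
    rw [upVar, hg]
    change _ - F (insert x S) ^ 2 / w (insert x S) = _
    ring
  rw [hR, upVar, hmean]
  rw [hexp, hfG, hGG] at hsq
  rw [zero_pow two_ne_zero, zero_div, sub_zero]
  linarith

theorem upVar_le_sum_upVar (hr : ∀ B ∈ 𝓑, B.card = r)
    (hA : ∀ S : Finset α, S.card + 2 ≤ r → ReverseCauchySchwarz (linkMatrix (upCount 𝓑) S))
    (f : Finset α → ℝ) (k : ℕ) : ∀ S : Finset α, S.card + 1 + k = r →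
      upVar 𝓑 f S ≤ ∑ T ∈ powersetCard (r - 1) univ with S ⊆ T, upVar 𝓑 f T := by
  induction k with
  | zero =>
    intro S hS
    have : (powersetCard (r - 1) univ).filter (fun T => S ⊆ T) = {S} := by
      ext T
      simp only [mem_filter, mem_powersetCard, subset_univ, true_and, mem_singleton]
      constructor
      · rintro ⟨h1, h2⟩
        exact (eq_of_subset_of_card_le h2 (by omega)).symm
      · rintro rfl
        exact ⟨by omega, Subset.rfl⟩
    rw [this, sum_singleton]
  | succ k ih =>
    intro S hS
    have hk : (r : ℝ) = S.card + 1 + (k + 1) := by exact_mod_cast hS.symm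
    have h1 := mul_upVar_le_sum_upVar_insert hr (by omega) (hA S (by omega)) f
    have h2 : ∑ x ∈ Sᶜ, upVar 𝓑 f (insert x S) ≤ ∑ x ∈ Sᶜ,
        ∑ T ∈ powersetCard (r - 1) univ with insert x S ⊆ T, upVar 𝓑 f T :=
      sum_le_sum fun x hx => ih _ (by rw [card_insert_of_notMem (mem_compl.1 hx)]; omega)
    rw [sum_compl_sum_insert_subset (n := r - 1) (fun T hT => (mem_powersetCard.1 hT).2),
      Nat.cast_sub (by omega)] at h2
    refine le_of_mul_le_mul_left ?_ (show (0 : ℝ) < k + 1 by positivity)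
    rw [hk] at h1 h2
    push_cast at h2
    linarith

end Variance

section Matroid

variable {α : Type*} [DecidableEq α] {ℐ : Finset (Finset α)}

theorem upCount_maximal_ne_zero_iff (hdown : ∀ T ∈ ℐ, ∀ S ⊆ T, S ∈ ℐ) {𝓑 : Finset (Finset α)}
    (h𝓑 : ∀ B, B ∈ 𝓑 ↔ Maximal (· ∈ ℐ) B) {S : Finset α} : upCount 𝓑 S ≠ 0 ↔ S ∈ ℐ := by
  rw [upCount_ne_zero]
  constructor
  · rintro ⟨B, hB, hSB⟩
    exact hdown B ((h𝓑 B).1 hB).prop S hSB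
  · intro hS
    obtain ⟨B, hSB, hB⟩ := ℐ.exists_le_maximal hS
    exact ⟨B, (h𝓑 B).2 hB, hSB⟩

/-- In the link of an independent set, non-adjacency is transitive. -/
theorem linkMatrix_ne_zero_or {w : Finset α → ℝ} (hw : ∀ S, w S ≠ 0 ↔ S ∈ ℐ)
    (hexch : ∀ T₁ ∈ ℐ, ∀ T₂ ∈ ℐ, T₂.card < T₁.card → ∃ i ∈ T₁ \ T₂, insert i T₂ ∈ ℐ)
    {S : Finset α} {x y z : α} (hxz : linkMatrix w S x z ≠ 0) (hy : linkVec w S y ≠ 0) :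
    linkMatrix w S x y ≠ 0 ∨ linkMatrix w S z y ≠ 0 := by
  simp only [linkMatrix_apply, linkVec, ne_eq, ite_eq_left_iff, Classical.not_imp] at hxz hy ⊢
  simp only [← ne_eq, hw, not_or] at hxz hy ⊢
  obtain ⟨⟨hx, hz, hne⟩, hI⟩ := hxz
  obtain ⟨hyS, hyI⟩ := hy
  obtain ⟨i, hi, hins⟩ := hexch _ hI _ hyI (by
    rw [card_insert_of_notMem hyS, card_insert_of_notMem (by simp [hx, hne]),
      card_insert_of_notMem hz]
    omega)
  simp only [mem_sdiff, mem_insert, not_or] at hi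
  obtain ⟨rfl | rfl | h, hiy, hiS⟩ := hi
  · exact Or.inl ⟨⟨hx, hyS, hiy⟩, hins⟩
  · exact Or.inr ⟨⟨hz, hyS, hiy⟩, hins⟩
  · exact absurd h hiS

end Matroid

/-- Summing over the facets of a set is summing over its points. -/
theorem sum_powersetCard_filter_subset {α : Type*} [Fintype α] [DecidableEq α] {B : Finset α}
    {r : ℕ} (hr : 1 ≤ r) (hB : B.card = r) (φ : Finset α → ℝ) :
    ∑ T ∈ powersetCard (r - 1) univ with T ⊆ B, φ T = ∑ x ∈ B, φ (B.erase x) := by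
  symm
  refine sum_bij (fun x _ => B.erase x) ?_ ?_ ?_ fun _ _ => rfl
  · intro x hx
    simp [mem_powersetCard, erase_subset, card_erase_of_mem hx, hB]
  · intro x hx y hy h
    by_contra hne
    have : x ∈ B.erase y := mem_erase.2 ⟨hne, hx⟩
    rw [← h] at this
    simp at this
  · intro T hT
    simp only [mem_filter, mem_powersetCard, subset_univ, true_and] at hT
    have h1 : (B \ T).card = 1 := by
      rw [card_sdiff_of_subset hT.2]
      omega
    obtain ⟨x, hx⟩ := card_eq_one.1 h1
    have hxB : x ∈ B \ T := hx ▸ mem_singleton_self x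
    refine ⟨x, (mem_sdiff.1 hxB).1, ?_⟩
    rw [← sdiff_singleton_eq_erase, ← hx, Finset.sdiff_sdiff_eq_self hT.2]

/-- **Spectral gap of the base exchange walk; Mihail–Vazirani.**
Let `ℐ` be a matroid of rank `r ≥ 1` on a finite ground set, `Bases` its set of bases,
`N S` the number of bases containing `S`, and `P` the base exchange walk
`P(B,B') = (1/r) · ∑_{x∈B, B∖{x}⊆B'} 1/N(B∖{x})`.  Then the second-largest eigenvalue of
`P` is at most `1 - 1/r`: every `f` on the bases with `∑_B f(B) = 0` satisfies
`∑_{B,B'} f(B)·P(B,B')·f(B') ≤ (1 - 1/r)·∑_B f(B)²`. -/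
theorem base_exchange_walk_gap {α : Type*} [Fintype α] [DecidableEq α]
    (ℐ : Finset (Finset α)) (hne : ℐ.Nonempty)
    (hdown : ∀ T ∈ ℐ, ∀ S ⊆ T, S ∈ ℐ)
    (hexch : ∀ T₁ ∈ ℐ, ∀ T₂ ∈ ℐ, T₂.card < T₁.card → ∃ i ∈ T₁ \ T₂, insert i T₂ ∈ ℐ)
    (Bases : Finset (Finset α))
    (hBases : Bases = ℐ.filter (fun B => ∀ T ∈ ℐ, B ⊆ T → B = T))
    (r : ℕ) (hr : 1 ≤ r)
    (hrank : ∀ B ∈ Bases, B.card = r)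
    (N : Finset α → ℕ)
    (hN : ∀ S : Finset α, N S = (Bases.filter (fun B => S ⊆ B)).card)
    (P : Finset α → Finset α → ℝ)
    (hP : ∀ B B' : Finset α, P B B' =
      (1 / (r : ℝ)) * ∑ x ∈ B.filter (fun x => B.erase x ⊆ B'), 1 / (N (B.erase x) : ℝ))
    (f : Finset α → ℝ)
    (hf : ∑ B ∈ Bases, f B = 0) :
    ∑ B ∈ Bases, ∑ B' ∈ Bases, f B * P B B' * f B' ≤
      (1 - 1 / (r : ℝ)) * ∑ B ∈ Bases, f B ^ 2 := by
  have hmax : ∀ B, B ∈ Bases ↔ Maximal (· ∈ ℐ) B := by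
    intro B
    rw [hBases, mem_filter]
    exact ⟨fun h => ⟨h.1, fun T hT hBT => (h.2 T hT hBT).ge⟩,
      fun h => ⟨h.prop, fun T hT hBT => h.eq_of_le hT hBT⟩⟩
  have hexch' : ∀ (S : Finset α) x y z, linkMatrix (upCount Bases) S x z ≠ 0 →
      (linkMatrix (upCount Bases) S *ᵥ 1) y ≠ 0 →
      linkMatrix (upCount Bases) S x y ≠ 0 ∨ linkMatrix (upCount Bases) S z y ≠ 0 := by
    intro S x y z hxz hy
    rw [linkMatrix_mulVec_one (sum_upCount_insert hrank)] at hy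
    exact linkMatrix_ne_zero_or (fun S => upCount_maximal_ne_zero_iff hdown hmax) hexch hxz
      (right_ne_zero_of_mul hy)
  have hbase : ∀ S : Finset α, S.card + 2 = r →
      ReverseCauchySchwarz (linkMatrix (upCount Bases) S) := by
    intro S hS
    refine .of_multipartite (linkMatrix_isSymm S) (fun x y => ?_)
      (fun x => by simp [linkMatrix_apply]) (hexch' S)
    rw [linkMatrix_apply]
    split_ifs with h
    · exact Or.inl rfl
    push Not at h
    have hle : (Bases.filter fun B => insert x (insert y S) ⊆ B).card ≤ 1 := by
      refine card_le_one.2 fun B hB C hC => ?_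
      have hcard : (insert x (insert y S)).card = r := by
        rw [card_insert_of_notMem (by simp [h.1, h.2.2]), card_insert_of_notMem h.2.1, ← hS]
      have huniq : ∀ D ∈ Bases.filter fun B => insert x (insert y S) ⊆ B,
          insert x (insert y S) = D := fun D hD =>
        eq_of_subset_of_card_le (mem_filter.1 hD).2 (by rw [hcard, hrank D (mem_filter.1 hD).1])
      rw [← huniq B hB, ← huniq C hC]
    rw [upCount]
    rcases Nat.le_one_iff_eq_zero_or_eq_one.1 hle with h | h <;> simp [h]
  have hA : ∀ S : Finset α, S.card + 2 ≤ r →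
      ReverseCauchySchwarz (linkMatrix (upCount Bases) S) := fun S hS =>
    reverseCauchySchwarz_linkMatrix (fun _ => Nat.cast_nonneg _) (sum_upCount_insert hrank)
      (fun S _ => hexch' S) hbase (r - (S.card + 2)) S (by omega)
  have hmain := upVar_le_sum_upVar hrank hA f (r - 1) ∅ (by rw [card_empty]; omega)
  have hr0 : (r : ℝ) ≠ 0 := by positivity
  have hfacet := fun B (hB : B ∈ Bases) => sum_powersetCard_filter_subset hr (hrank B hB)
  have hsq : ∑ T ∈ powersetCard (r - 1) univ, ∑ B ∈ Bases with T ⊆ B, f B ^ 2 =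
      r * ∑ B ∈ Bases, f B ^ 2 := by
    simp only [sum_filter]
    rw [sum_comm, mul_sum]
    refine sum_congr rfl fun B hB => ?_
    rw [← sum_filter, hfacet B hB, sum_const, hrank B hB, nsmul_eq_mul]
  have hwalk : ∑ B ∈ Bases, ∑ B' ∈ Bases, f B * P B B' * f B' = 1 / (r : ℝ) *
      ∑ T ∈ powersetCard (r - 1) univ, (∑ B ∈ Bases with T ⊆ B, f B) ^ 2 / upCount Bases T := by
    have h1 : ∀ T, (∑ B ∈ Bases with T ⊆ B, f B) ^ 2 / upCount Bases T =
        ∑ B ∈ Bases, ∑ B' ∈ Bases,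
          if T ⊆ B then (if T ⊆ B' then f B * (1 / (N T : ℝ)) * f B' else 0) else 0 := by
      intro T
      rw [upCount, ← hN, sq, sum_mul_sum, sum_div, sum_filter]
      refine sum_congr rfl fun B _ => ?_
      split_ifs
      · rw [sum_filter, sum_div]
        refine sum_congr rfl fun B' _ => ?_
        split_ifs <;> ring
      · simp
    simp only [h1]
    rw [sum_comm (s := powersetCard (r - 1) univ), mul_sum]
    refine sum_congr rfl fun B hB => ?_
    rw [sum_comm (s := powersetCard (r - 1) univ), mul_sum]
    refine sum_congr rfl fun B' _ => ?_
    rw [← sum_filter, hfacet B hB, hP, sum_filter]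
    simp only [mul_sum, sum_mul]
    refine sum_congr rfl fun x _ => ?_
    split_ifs <;> ring
  simp only [upVar, empty_subset, filter_true, hf, sum_sub_distrib, hsq] at hmain
  rw [zero_pow two_ne_zero, zero_div, sub_zero] at hmain
  rw [hwalk, one_sub_div hr0, one_div_mul_eq_div, div_mul_eq_mul_div]
  exact div_le_div_of_nonneg_right (by linarith) (by positivity)
end
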